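/- arXiv:2507.03481 — 2 statements merged into one kernel-verified Lean document; each statement's English description precedes it below -/
import Mathlib

section
/- For every transmission rate t > 0 and every ε > 0 there exists n₀ such that for all n ≥ n₀ the following holds with k = ⌊tn⌋: for every admissible partition 𝒜₁, …, 𝒜ₘ of 𝒱^k with associated compositions Q₁, …, Qₘ ∈ 𝒫ₙ(𝒳), there exists a joint source-channel code of parameters (k, n) whose error probability satisfies p_e ≤ e^{nε} · Σ_{c=1}^{m} Σ_{Pᵢ ∈ Λ_c} exp(−n[ t·e(H(Pᵢ), P_V) + E′_ex(Q_c, t·H(Pᵢ)) ]). -/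
open scoped Classical BigOperators

noncomputable section

/-- `P` is a probability distribution on the finite alphabet `α`. -/
def IsProbDist {α : Type} [Fintype α] (P : α → ℝ) : Prop :=
  (∀ a, 0 ≤ P a) ∧ ∑ a, P a = 1

/-- `W` is a discrete memoryless channel (a stochastic matrix). -/
def IsDMC {X Y : Type} [Fintype Y] (W : X → Y → ℝ) : Prop :=
  (∀ x y, 0 ≤ W x y) ∧ ∀ x, ∑ y, W x y = 1

/-- Product extension of a distribution: `P^k(v) = ∏ P(vᵢ)`. -/
def prodDist {α : Type} (P : α → ℝ) {k : ℕ} (v : Fin k → α) : ℝ := ∏ i, P (v i)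

/-- Product extension of a channel: `W^n(y|x) = ∏ W(y_l|x_l)`. -/
def Wn {X Y : Type} (W : X → Y → ℝ) {n : ℕ} (x : Fin n → X) (y : Fin n → Y) : ℝ :=
  ∏ l, W (x l) (y l)

/-- Shannon entropy (natural logarithm). -/
def entH {α : Type} [Fintype α] (P : α → ℝ) : ℝ := -∑ a, P a * Real.log (P a)

/-- Kullback–Leibler divergence `D(P‖Q)`. -/
def KL {α : Type} [Fintype α] (P Q : α → ℝ) : ℝ := ∑ a, P a * Real.log (P a / Q a)

/-- Empirical distribution (type) of a sequence. -/
def empDist {α : Type} [Fintype α] {k : ℕ} (v : Fin k → α) : α → ℝ :=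
  fun a => ((Finset.univ.filter fun i => v i = a).card : ℝ) / k

/-- Type class `T^k(P)`: sequences of length `k` with empirical distribution `P`. -/
def typeClass {α : Type} [Fintype α] (k : ℕ) (P : α → ℝ) : Finset (Fin k → α) :=
  Finset.univ.filter fun v => empDist v = P

/-- `P` is a type of length-`k` sequences, i.e. `P ∈ 𝒫ₖ(α)`. -/
def IsType {α : Type} [Fintype α] (k : ℕ) (P : α → ℝ) : Prop :=
  ∃ v : Fin k → α, empDist v = P

/-- Source reliability function `e(R, P_V) = min_{Q : H(Q) ≥ R} D(Q‖P_V)`. -/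
def srcRel {V : Type} [Fintype V] (PV : V → ℝ) (R : ℝ) : ℝ :=
  sInf { z | ∃ Q : V → ℝ, IsProbDist Q ∧ R ≤ entH Q ∧ z = KL Q PV }

/-- Bhattacharyya distance. -/
def dB {X Y : Type} [Fintype Y] (W : X → Y → ℝ) (x x' : X) : ℝ :=
  -Real.log (∑ y, Real.sqrt (W x y * W x' y))

/-- Mutual information of a joint distribution on `X × X`. -/
def mutualInfo {X : Type} [Fintype X] (P : X × X → ℝ) : ℝ :=
  ∑ p : X × X, P p * Real.log (P p / ((∑ x', P (p.1, x')) * (∑ x, P (x, p.2))))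

/-- Weak expurgated exponent `E'_ex(Q, R)`. -/
def Eex' {X Y : Type} [Fintype X] [Fintype Y] (W : X → Y → ℝ) (Q : X → ℝ) (R : ℝ) : ℝ :=
  sInf { z | ∃ P : X × X → ℝ, IsProbDist P ∧ (∀ x, ∑ x', P (x, x') = Q x) ∧
    mutualInfo P ≤ R ∧
    z = (∑ p : X × X, P p * dB W p.1 p.2) + mutualInfo P - R }

/-- Gallager source function `E_s(ρ, P_V)`. -/
def Es {α : Type} [Fintype α] (PV : α → ℝ) (ρ : ℝ) : ℝ :=
  (1 + ρ) * Real.log (∑ v, PV v ^ (1 / (1 + ρ)))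

/-- Dual weak expurgated function `E'_x(Q, ρ)`. -/
def Ex' {X Y : Type} [Fintype X] [Fintype Y] (W : X → Y → ℝ) (Q : X → ℝ) (ρ : ℝ) : ℝ :=
  sInf { z | ∃ Q' : X → ℝ, IsProbDist Q' ∧
    z = -ρ * ∑ x, Q x * Real.log (∑ x', Q' x' * Real.exp (-dB W x x' / ρ)) }

/-- Constant-composition expurgated dual function `E_x(Q, ρ)`. -/
def Ex {X Y : Type} [Fintype X] [Fintype Y] (W : X → Y → ℝ) (Q : X → ℝ) (ρ : ℝ) : ℝ :=
  sSup { z | ∃ a : X → ℝ,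
    z = -ρ * ∑ x, Q x * Real.log (∑ x', Q x' *
      (Real.exp (-dB W x x') * Real.exp (a x' - a x)) ^ (1 / ρ)) }

/-- Error probability of a joint source-channel code `(f, φ)`. -/
def pErr {V X Y : Type} [Fintype V] [Fintype X] [Fintype Y] (PV : V → ℝ)
    (W : X → Y → ℝ) {k n : ℕ}
    (f : (Fin k → V) → Fin n → X) (φ : (Fin n → Y) → Fin k → V) : ℝ :=
  ∑ v : Fin k → V, prodDist PV v *
    ∑ y ∈ Finset.univ.filter (fun y : Fin n → Y => φ y ≠ v), Wn W (f v) y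

/-- The set `Λ_c` of source types belonging to class `c` of the partition `cls`. -/
def classTypes {V : Type} [Fintype V] {k m : ℕ} (cls : (Fin k → V) → Fin m)
    (c : Fin m) : Finset (V → ℝ) :=
  Finset.image empDist (Finset.univ.filter fun v => cls v = c)

/-- An admissible partition of `𝒱^k`: classes are unions of source type classes, and
each class `c` carries a composition `Q_c ∈ 𝒫ₙ(𝒳)` whose type class is at least as
large as the class. -/
def AdmissiblePartition {V X : Type} [Fintype V] [Fintype X] (n : ℕ) {k m : ℕ}
    (cls : (Fin k → V) → Fin m) (Qc : Fin m → X → ℝ) : Prop :=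
  (∀ v v' : Fin k → V, empDist v = empDist v' → cls v = cls v') ∧
  (∀ c, IsType n (Qc c)) ∧
  (∀ c, (Finset.univ.filter fun v : Fin k → V => cls v = c).card ≤ (typeClass n (Qc c)).card)



lemma aux_cnt {α : Type} [Fintype α] {k : ℕ} (hk : 0 < k) (v w : Fin k → α)
    (h : empDist v = empDist w) (a : α) :
    (Finset.univ.filter fun i => v i = a).card = (Finset.univ.filter fun i => w i = a).card := by
  have h1 := congrFun h a
  unfold empDist at h1
  have hk' : (k : ℝ) ≠ 0 := by positivity
  field_simp at h1
  exact_mod_cast h1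

lemma aux_empDist_eq {α : Type} [Fintype α] {k : ℕ} (v w : Fin k → α)
    (h : ∀ a, (Finset.univ.filter fun i => v i = a).card
      = (Finset.univ.filter fun i => w i = a).card) : empDist v = empDist w := by
  funext a
  unfold empDist
  rw [h a]

lemma aux_typeClass_factorial {α : Type} [Fintype α] {n : ℕ} (hn : 0 < n) (x : Fin n → α) :
    (typeClass n (empDist x)).card *
      ∏ a, (Finset.univ.filter fun i => x i = a).card.factorial = n.factorial := by
  have h1 : (Finset.univ : Finset (Equiv.Perm (Fin n))).card =
      ∑ y ∈ typeClass n (empDist x),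
        (Finset.univ.filter fun g : Equiv.Perm (Fin n) => x ∘ g = y).card := by
    apply Finset.card_eq_sum_card_fiberwise
    intro g _
    simp only [typeClass, Finset.coe_filter, Finset.mem_univ, true_and, Set.mem_ofPred_eq]
    apply aux_empDist_eq
    intro a
    apply Finset.card_bij (fun i _ => g i)
    · intro i hi
      simpa using hi
    · intro i _ j _ h
      exact g.injective h
    · intro j hj
      exact ⟨g.symm j, by simpa using hj, by simp⟩
  have h0 : (Finset.univ.filter fun g : Equiv.Perm (Fin n) => x ∘ g = x).card
      = ∏ a, (Finset.univ.filter fun i => x i = a).card.factorial := by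
    have := DomMulAct.stabilizer_card x
    rw [Fintype.card_subtype] at this
    rw [this]
    apply Finset.prod_congr rfl
    intro a _
    rw [Fintype.card_subtype]
  have h2 : ∀ y ∈ typeClass n (empDist x),
      (Finset.univ.filter fun g : Equiv.Perm (Fin n) => x ∘ g = y).card
      = ∏ a, (Finset.univ.filter fun i => x i = a).card.factorial := by
    intro y hy
    rw [← h0]
    simp only [typeClass, Finset.mem_filter, Finset.mem_univ, true_and] at hy
    have hc := aux_cnt hn _ _ hy
    have e : ∀ c, Nonempty ({ i // y i = c } ≃ { i // x i = c }) := by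
      intro c
      refine ⟨Fintype.equivOfCardEq ?_⟩
      rw [Fintype.card_subtype, Fintype.card_subtype]
      exact hc c
    let g0 : Equiv.Perm (Fin n) := Equiv.ofFiberEquiv (fun c => (e c).some)
    have hg0 : ∀ i, x (g0 i) = y i := fun i => Equiv.ofFiberEquiv_map _ i
    symm
    apply Finset.card_bij (fun g _ => g * g0)
    · intro g hg
      simp only [Finset.mem_filter, Finset.mem_univ, true_and] at hg ⊢
      funext i
      have := congrFun hg (g0 i)
      simp only [Function.comp_apply, Equiv.Perm.coe_mul] at this ⊢
      rw [this, hg0]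
    · intro g _ g' _ h
      exact mul_right_cancel h
    · intro g hg
      simp only [Finset.mem_filter, Finset.mem_univ, true_and] at hg
      refine ⟨g * g0⁻¹, ?_, by simp⟩
      simp only [Finset.mem_filter, Finset.mem_univ, true_and]
      funext i
      have := congrFun hg (g0⁻¹ i)
      simp only [Function.comp_apply, Equiv.Perm.coe_mul] at this ⊢
      rw [this, ← hg0]
      simp
  rw [Finset.sum_congr rfl h2, Finset.sum_const, smul_eq_mul] at h1
  rw [← h1, Finset.card_univ, Fintype.card_perm, Fintype.card_fin]

lemma aux_pow_fact (k r : ℕ) : k.factorial * k ^ r ≤ r.factorial * k ^ k := by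
  rcases le_total k r with h | h
  · have := Nat.factorial_mul_pow_sub_le_factorial h
    calc k.factorial * k ^ r = (k.factorial * k ^ (r - k)) * k ^ k := by
          rw [mul_assoc, ← pow_add, Nat.sub_add_cancel h]
      _ ≤ _ := Nat.mul_le_mul_right _ this
  · have := Nat.factorial_le_pow (k - r)
    have h3 : k.factorial ≤ r.factorial * k ^ (k - r) := by
      have := Nat.factorial_mul_descFactorial (n := k) (k := k - r) (by omega)
      rw [← this, show k - (k - r) = r by omega]
      exact Nat.mul_le_mul_left _ (Nat.descFactorial_le_pow _ _)
    calc k.factorial * k ^ r ≤ (r.factorial * k ^ (k - r)) * k ^ r := Nat.mul_le_mul_right _ h3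
      _ = _ := by rw [mul_assoc, ← pow_add, Nat.sub_add_cancel h]

lemma aux_prod_cnt {α M : Type} [Fintype α] [CommMonoid M] {n : ℕ} (x : Fin n → α) (g : α → M) :
    ∏ l, g (x l) = ∏ a, g a ^ (Finset.univ.filter fun i => x i = a).card := by
  rw [← Finset.prod_fiberwise Finset.univ x]
  apply Finset.prod_congr rfl
  intro a _
  rw [← Finset.prod_const]
  apply Finset.prod_congr rfl
  intro i hi
  simp only [Finset.mem_filter] at hi
  rw [hi.2]

lemma aux_class_compare {α : Type} [Fintype α] {n : ℕ} (hn : 0 < n) (x y : Fin n → α) :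
    ((typeClass n (empDist y)).card : ℝ) * ∏ l, empDist x (y l)
      ≤ (typeClass n (empDist x)).card * ∏ l, empDist x (x l) := by
  set c : α → ℕ := fun a => (Finset.univ.filter fun i => x i = a).card with hc
  set r : α → ℕ := fun a => (Finset.univ.filter fun i => y i = a).card with hr
  have hx := aux_typeClass_factorial hn x
  have hy := aux_typeClass_factorial hn y
  have key : (typeClass n (empDist y)).card * ∏ l, c (y l)
      ≤ (typeClass n (empDist x)).card * ∏ l, c (x l) := by
    rw [aux_prod_cnt y, aux_prod_cnt x]
    have hpos : 0 < (∏ a, (r a).factorial) * ∏ a, (c a).factorial :=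
      Nat.mul_pos (Finset.prod_pos fun a _ => Nat.factorial_pos _)
        (Finset.prod_pos fun a _ => Nat.factorial_pos _)
    apply Nat.le_of_mul_le_mul_left _ hpos
    calc _ = ((typeClass n (empDist y)).card * ∏ a, (r a).factorial) *
          ∏ a, ((c a).factorial * c a ^ r a) := by
            rw [Finset.prod_mul_distrib]; ring
      _ ≤ ((typeClass n (empDist y)).card * ∏ a, (r a).factorial) *
          ∏ a, ((r a).factorial * c a ^ c a) :=
            Nat.mul_le_mul_left _ (Finset.prod_le_prod' fun a _ => aux_pow_fact _ _)
      _ = ((typeClass n (empDist x)).card * ∏ a, (c a).factorial) *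
          ∏ a, ((r a).factorial * c a ^ c a) := by rw [hy, ← hx]
      _ = _ := by rw [Finset.prod_mul_distrib]; ring
  have e : ∀ z : Fin n → α, ∏ l, empDist x (z l) = ((∏ l, c (z l) : ℕ) : ℝ) / (n : ℝ) ^ n := by
    intro z
    simp only [empDist]
    rw [Finset.prod_div_distrib]
    simp [hc]
  rw [e, e, ← mul_div_assoc, ← mul_div_assoc]
  apply div_le_div_of_nonneg_right _ (by positivity)
  exact_mod_cast key

lemma aux_num_types {α : Type} [Fintype α] (n : ℕ) (s : Finset (Fin n → α)) :
    ((s.image empDist).card : ℝ) ≤ ((n : ℝ) + 1) ^ Fintype.card α := by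
  have h : (s.image empDist).card ≤ (n + 1) ^ Fintype.card α := by
    have : (s.image empDist) ⊆ (Finset.univ : Finset (α → Fin (n + 1))).image
        (fun g a => ((g a : ℕ) : ℝ) / n) := by
      intro P hP
      simp only [Finset.mem_image, Finset.mem_univ, true_and] at hP ⊢
      obtain ⟨v, _, rfl⟩ := hP
      refine ⟨fun a => ⟨(Finset.univ.filter fun i => v i = a).card, ?_⟩, ?_⟩
      · have := Finset.card_filter_le (Finset.univ : Finset (Fin n)) (fun i => v i = a)
        simp only [Finset.card_univ, Fintype.card_fin] at this
        omega
      · rfl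
    refine (Finset.card_le_card this).trans (Finset.card_image_le.trans ?_)
    simp
  exact_mod_cast h

lemma aux_emp_nonneg {α : Type} [Fintype α] {n : ℕ} (x : Fin n → α) (a : α) : 0 ≤ empDist x a := by
  unfold empDist; positivity

lemma aux_emp_sum {α : Type} [Fintype α] {n : ℕ} (x : Fin n → α) (g : α → ℝ) :
    ∑ l, g (x l) = n * ∑ a, empDist x a * g a := by
  rcases Nat.eq_zero_or_pos n with h | h
  · subst h; simp
  rw [← Finset.sum_fiberwise Finset.univ x, Finset.mul_sum]
  apply Finset.sum_congr rfl
  intro a _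
  have : ∑ i with x i = a, g (x i) = ∑ i with x i = a, g a := by
    apply Finset.sum_congr rfl
    intro i hi
    simp only [Finset.mem_filter] at hi
    rw [hi.2]
  rw [this, Finset.sum_const, nsmul_eq_mul]
  unfold empDist
  have hk' : (n : ℝ) ≠ 0 := by positivity
  field_simp

lemma aux_emp_prob {α : Type} [Fintype α] {n : ℕ} (hn : 0 < n) (x : Fin n → α) :
    IsProbDist (empDist x) := by
  refine ⟨aux_emp_nonneg x, ?_⟩
  have := aux_emp_sum x (fun _ => 1)
  simp only [Finset.sum_const, Finset.card_univ, Fintype.card_fin, nsmul_eq_mul, mul_one] at this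
  have hk' : (n : ℝ) ≠ 0 := by positivity
  field_simp at this
  exact this.symm

lemma aux_emp_pos {α : Type} [Fintype α] {n : ℕ} (x : Fin n → α) (l : Fin n) :
    0 < empDist x (x l) := by
  unfold empDist
  have : 0 < n := Fin.pos l
  have : 0 < (Finset.univ.filter fun i => x i = x l).card :=
    Finset.card_pos.2 ⟨l, by simp⟩
  positivity

lemma aux_prod_emp {α : Type} [Fintype α] {n : ℕ} (x : Fin n → α) :
    ∏ l, empDist x (x l) = Real.exp (-(n * entH (empDist x))) := by
  have h : ∀ l, empDist x (x l) = Real.exp (Real.log (empDist x (x l))) := fun l =>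
    (Real.exp_log (aux_emp_pos x l)).symm
  rw [Finset.prod_congr rfl fun l _ => h l, ← Real.exp_sum,
    aux_emp_sum x (fun a => Real.log (empDist x a))]
  unfold entH
  ring_nf

lemma aux_sum_prod {α : Type} [Fintype α] {n : ℕ} (P : α → ℝ) (hP : IsProbDist P) :
    ∑ x : Fin n → α, ∏ l, P (x l) = 1 := by
  rw [← Fintype.prod_sum (fun _ a => P a)]
  simp [hP.2]

lemma aux_class_upper {α : Type} [Fintype α] {n : ℕ} (hn : 0 < n) (x : Fin n → α) :
    ((typeClass n (empDist x)).card : ℝ) ≤ Real.exp (n * entH (empDist x)) := by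
  have h1 := aux_sum_prod (n := n) _ (aux_emp_prob hn x)
  have h2 : ∑ y ∈ typeClass n (empDist x), ∏ l, empDist x (y l) ≤ 1 := by
    rw [← h1]
    apply Finset.sum_le_sum_of_subset_of_nonneg (Finset.subset_univ _)
    intro y _ _
    exact Finset.prod_nonneg fun l _ => aux_emp_nonneg _ _
  have h3 : ∀ y ∈ typeClass n (empDist x), ∏ l, empDist x (y l)
      = Real.exp (-(n * entH (empDist x))) := by
    intro y hy
    simp only [typeClass, Finset.mem_filter, Finset.mem_univ, true_and] at hy
    rw [← hy, aux_prod_emp]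
  rw [Finset.sum_congr rfl h3, Finset.sum_const, nsmul_eq_mul, Real.exp_neg] at h2
  have := Real.exp_pos (n * entH (empDist x))
  rwa [← div_eq_mul_inv, div_le_one this] at h2

lemma aux_class_lower {α : Type} [Fintype α] {n : ℕ} (hn : 0 < n) (x : Fin n → α) :
    Real.exp (n * entH (empDist x)) ≤
      ((n : ℝ) + 1) ^ Fintype.card α * (typeClass n (empDist x)).card := by
  have h1 := aux_sum_prod (n := n) _ (aux_emp_prob hn x)
  rw [← Finset.sum_fiberwise_of_maps_to (g := empDist) (t := Finset.univ.image empDist)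
    (fun i _ => Finset.mem_image_of_mem _ (Finset.mem_univ i))] at h1
  have h2 : ∀ P ∈ (Finset.univ : Finset (Fin n → α)).image empDist,
      ∑ y : Fin n → α with empDist y = P, ∏ l, empDist x (y l)
        ≤ (typeClass n (empDist x)).card * Real.exp (-(n * entH (empDist x))) := by
    intro P hP
    simp only [Finset.mem_image, Finset.mem_univ, true_and] at hP
    obtain ⟨y, rfl⟩ := hP
    rw [← aux_prod_emp]
    refine le_trans (le_of_eq ?_) (aux_class_compare hn x y)
    have : ∀ z ∈ (Finset.univ.filter fun z : Fin n → α => empDist z = empDist y),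
        ∏ l, empDist x (z l) = ∏ l, empDist x (y l) := by
      intro z hz
      simp only [Finset.mem_filter, Finset.mem_univ, true_and] at hz
      rw [aux_prod_cnt z, aux_prod_cnt y]
      apply Finset.prod_congr rfl
      intro a _
      rw [aux_cnt hn z y hz a]
    rw [Finset.sum_congr rfl this, Finset.sum_const, nsmul_eq_mul]
    rfl
  have h3 := Finset.sum_le_sum h2
  rw [h1, Finset.sum_const, nsmul_eq_mul, Real.exp_neg] at h3
  have hp := Real.exp_pos (n * entH (empDist x))
  have h4 := aux_num_types n (Finset.univ : Finset (Fin n → α))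
  rw [← mul_assoc, ← div_eq_mul_inv, le_div_iff₀ hp, one_mul] at h3
  exact h3.trans (mul_le_mul_of_nonneg_right h4 (Nat.cast_nonneg _))

lemma aux_klterm (p q : ℝ) (hp : 0 ≤ p) (hq : 0 ≤ q) (h : q = 0 → p = 0) :
    p - q + (√p - √q) ^ 2 ≤ p * Real.log (p / q) := by
  rcases hp.eq_or_lt with h0 | h0
  · subst h0
    simp [Real.sq_sqrt hq]
  have hq0 : 0 < q := lt_of_le_of_ne hq fun h' => by
    have := h h'.symm
    linarith
  have hsp := Real.sqrt_pos.2 h0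
  have hsq := Real.sqrt_pos.2 hq0
  have e1 : Real.log (p / q) = -2 * Real.log (√q / √p) := by
    rw [Real.log_div h0.ne' hq0.ne', Real.log_div hsq.ne' hsp.ne', Real.log_sqrt hp,
      Real.log_sqrt hq]
    ring
  have e2 := Real.log_le_sub_one_of_pos (div_pos hsq hsp)
  have e3 : p * (√q / √p) = √p * √q := by
    field_simp
    rw [Real.sq_sqrt hp]
  have e4 : p * Real.log (√q / √p) ≤ √p * √q - p := by
    calc _ ≤ p * (√q / √p - 1) := mul_le_mul_of_nonneg_left e2 hp
      _ = _ := by rw [mul_sub, e3, mul_one]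
  rw [e1]
  have s1 := Real.sq_sqrt hp
  have s2 := Real.sq_sqrt hq
  nlinarith

/-- product of the marginals -/
def auxR {X : Type} [Fintype X] (P : X × X → ℝ) (p : X × X) : ℝ :=
  (∑ x', P (p.1, x')) * (∑ x, P (x, p.2))

section
variable {X : Type} [Fintype X]

lemma auxR_nonneg {P : X × X → ℝ} (hP : IsProbDist P) (p : X × X) : 0 ≤ auxR P p :=
  mul_nonneg (Finset.sum_nonneg fun _ _ => hP.1 _) (Finset.sum_nonneg fun _ _ => hP.1 _)

lemma auxR_zero {P : X × X → ℝ} (hP : IsProbDist P) (p : X × X) (h : auxR P p = 0) : P p = 0 := by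
  unfold auxR at h
  rcases mul_eq_zero.1 h with h | h
  · exact (Finset.sum_eq_zero_iff_of_nonneg fun _ _ => hP.1 _).1 h p.2 (Finset.mem_univ _)
  · exact (Finset.sum_eq_zero_iff_of_nonneg fun _ _ => hP.1 _).1 h p.1 (Finset.mem_univ _)

lemma aux_marg_sum {P : X × X → ℝ} (hP : IsProbDist P) : ∑ x, ∑ x', P (x, x') = 1 := by
  rw [← hP.2, Fintype.sum_prod_type]

lemma aux_marg_sum2 {P : X × X → ℝ} (hP : IsProbDist P) : ∑ x', ∑ x, P (x, x') = 1 := by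
  rw [← hP.2, Fintype.sum_prod_type_right]

lemma auxR_fst {P : X × X → ℝ} (hP : IsProbDist P) (x : X) :
    ∑ x', auxR P (x, x') = ∑ x', P (x, x') := by
  unfold auxR
  simp only
  rw [← Finset.mul_sum, aux_marg_sum2 hP, mul_one]

lemma auxR_snd {P : X × X → ℝ} (hP : IsProbDist P) (x' : X) :
    ∑ x, auxR P (x, x') = ∑ x, P (x, x') := by
  unfold auxR
  simp only
  rw [← Finset.sum_mul, aux_marg_sum hP, one_mul]

lemma auxR_sum {P : X × X → ℝ} (hP : IsProbDist P) : ∑ p, auxR P p = 1 := by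
  rw [Fintype.sum_prod_type, Finset.sum_congr rfl fun x _ => auxR_fst hP x, aux_marg_sum hP]

lemma aux_le_one {α : Type} [Fintype α] {P : α → ℝ} (hP : IsProbDist P) (a : α) : P a ≤ 1 := by
  rw [← hP.2]
  exact Finset.single_le_sum (fun i _ => hP.1 i) (Finset.mem_univ a)

lemma auxR_prob {P : X × X → ℝ} (hP : IsProbDist P) : IsProbDist (auxR P) :=
  ⟨auxR_nonneg hP, auxR_sum hP⟩

lemma aux_mi_eq (P : X × X → ℝ) : mutualInfo P = ∑ p, P p * Real.log (P p / auxR P p) := rfl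

lemma aux_mi_hell {P : X × X → ℝ} (hP : IsProbDist P) :
    ∑ p, (√(P p) - √(auxR P p)) ^ 2 ≤ mutualInfo P := by
  rw [aux_mi_eq]
  have := Finset.sum_le_sum fun p (_ : p ∈ Finset.univ) =>
    aux_klterm (P p) (auxR P p) (hP.1 p) (auxR_nonneg hP p) (auxR_zero hP p)
  rw [Finset.sum_add_distrib, Finset.sum_sub_distrib, hP.2, auxR_sum hP] at this
  linarith

lemma aux_mi_nonneg {P : X × X → ℝ} (hP : IsProbDist P) : 0 ≤ mutualInfo P :=
  le_trans (Finset.sum_nonneg fun _ _ => sq_nonneg _) (aux_mi_hell hP)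

lemma aux_tv {P : X × X → ℝ} (hP : IsProbDist P) (p : X × X) :
    |auxR P p - P p| ≤ 2 * √(mutualInfo P) := by
  have h1 : (√(P p) - √(auxR P p)) ^ 2 ≤ mutualInfo P :=
    le_trans (Finset.single_le_sum (f := fun p => (√(P p) - √(auxR P p)) ^ 2)
      (fun _ _ => sq_nonneg _) (Finset.mem_univ p)) (aux_mi_hell hP)
  have h2 := Real.abs_le_sqrt h1
  have hp := hP.1 p
  have hr := auxR_nonneg hP p
  have e : auxR P p - P p = -(√(P p) - √(auxR P p)) * (√(P p) + √(auxR P p)) := by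
    have s1 := Real.sq_sqrt hp
    have s2 := Real.sq_sqrt hr
    nlinarith
  have h3 : √(P p) ≤ 1 := Real.sqrt_le_one.2 (aux_le_one hP p)
  have h4 : √(auxR P p) ≤ 1 := Real.sqrt_le_one.2 (aux_le_one (auxR_prob hP) p)
  rw [e, abs_mul, abs_neg, abs_of_nonneg (by positivity : 0 ≤ √(P p) + √(auxR P p)), mul_comm 2]
  exact mul_le_mul h2 (by linarith) (by positivity) (Real.sqrt_nonneg _)

/-- mixture with the product of marginals -/
def auxMix (lam : ℝ) (P : X × X → ℝ) (p : X × X) : ℝ := (1 - lam) * P p + lam * auxR P p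

lemma auxMix_prob {P : X × X → ℝ} (hP : IsProbDist P) {lam : ℝ} (h0 : 0 ≤ lam) (h1 : lam ≤ 1) :
    IsProbDist (auxMix lam P) := by
  refine ⟨fun p => ?_, ?_⟩
  · have := hP.1 p
    have := auxR_nonneg hP p
    have : 0 ≤ 1 - lam := by linarith
    unfold auxMix; positivity
  · unfold auxMix
    rw [Finset.sum_add_distrib, ← Finset.mul_sum, ← Finset.mul_sum, hP.2, auxR_sum hP]; ring

lemma auxMix_fst {P : X × X → ℝ} (hP : IsProbDist P) (lam : ℝ) (x : X) :
    ∑ x', auxMix lam P (x, x') = ∑ x', P (x, x') := by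
  unfold auxMix
  rw [Finset.sum_add_distrib, ← Finset.mul_sum, ← Finset.mul_sum, auxR_fst hP]; ring

lemma auxMix_snd {P : X × X → ℝ} (hP : IsProbDist P) (lam : ℝ) (x' : X) :
    ∑ x, auxMix lam P (x, x') = ∑ x, P (x, x') := by
  unfold auxMix
  rw [Finset.sum_add_distrib, ← Finset.mul_sum, ← Finset.mul_sum, auxR_snd hP]; ring

lemma auxMix_R {P : X × X → ℝ} (hP : IsProbDist P) (lam : ℝ) (p : X × X) :
    auxR (auxMix lam P) p = auxR P p := by
  unfold auxR
  rw [auxMix_fst hP, auxMix_snd hP]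

lemma auxMix_mi {P : X × X → ℝ} (hP : IsProbDist P) {lam : ℝ} (h0 : 0 ≤ lam) (h1 : lam ≤ 1) :
    mutualInfo (auxMix lam P) ≤ (1 - lam) * mutualInfo P := by
  rw [aux_mi_eq, aux_mi_eq, Finset.mul_sum]
  apply Finset.sum_le_sum
  intro p _
  rw [auxMix_R hP]
  have hp := hP.1 p
  rcases (auxR_nonneg hP p).eq_or_lt with h | h
  · rw [← h]; simp
  · obtain ⟨_, hcv⟩ := Real.convexOn_mul_log
    have hc := hcv (x := P p / auxR P p) (Set.mem_Ici.2 (by positivity))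
      (y := 1) (Set.mem_Ici.2 (by norm_num))
      (a := 1 - lam) (b := lam) (by linarith) h0 (by ring)
    simp only [smul_eq_mul, mul_one, Real.log_one, mul_zero, add_zero] at hc
    have e : auxMix lam P p = auxR P p * ((1 - lam) * (P p / auxR P p) + lam) := by
      unfold auxMix; field_simp
    have e' : auxMix lam P p / auxR P p = (1 - lam) * (P p / auxR P p) + lam := by
      rw [e]; field_simp
    rw [e', e, mul_assoc]
    calc _ ≤ auxR P p * ((1 - lam) * (P p / auxR P p * Real.log (P p / auxR P p))) :=
          mul_le_mul_of_nonneg_left hc h.le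
      _ = _ := by field_simp

variable {Y : Type} [Fintype Y]

lemma aux_Eex_le (W : X → Y → ℝ) (Q : X → ℝ) (R : ℝ) (P : X × X → ℝ) (hP : IsProbDist P)
    (hQ : ∀ x, ∑ x', P (x, x') = Q x) (hI : mutualInfo P ≤ R) :
    Eex' W Q R ≤ (∑ p : X × X, P p * dB W p.1 p.2) + mutualInfo P - R := by
  apply csInf_le
  · refine ⟨-(∑ p : X × X, |dB W p.1 p.2|) - R, ?_⟩
    rintro z ⟨P', hP', _, _, rfl⟩
    have h1 := aux_mi_nonneg hP'
    have h2 : -(∑ p : X × X, |dB W p.1 p.2|) ≤ ∑ p : X × X, P' p * dB W p.1 p.2 := by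
      rw [← Finset.sum_neg_distrib]
      apply Finset.sum_le_sum
      intro p _
      have a := neg_abs_le (dB W p.1 p.2)
      have b := abs_nonneg (dB W p.1 p.2)
      have c := hP'.1 p
      have d := aux_le_one hP' p
      nlinarith
    linarith
  · exact ⟨P, hP, hQ, hI, rfl⟩

lemma aux_Eex_cont (W : X → Y → ℝ) (Q : X → ℝ) (R δ : ℝ) (hR : 0 ≤ R) (hδ : 0 < δ)
    (P : X × X → ℝ) (hP : IsProbDist P)
    (hQ : ∀ x, ∑ x', P (x, x') = Q x) (hI : mutualInfo P ≤ R + δ) :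
    Eex' W Q R ≤ (∑ p : X × X, P p * dB W p.1 p.2) + mutualInfo P - R
      + 2 * (∑ p : X × X, |dB W p.1 p.2|) * √δ := by
  have hs : 0 < R + δ := by linarith
  set lam := δ / (R + δ) with hlam
  have h0 : 0 ≤ lam := by positivity
  have h1 : lam ≤ 1 := by rw [hlam, div_le_one hs]; linarith
  have hmi := auxMix_mi hP h0 h1
  have hnn := aux_mi_nonneg hP
  have hle : mutualInfo (auxMix lam P) ≤ R := by
    refine hmi.trans ?_
    calc _ ≤ (1 - lam) * (R + δ) := mul_le_mul_of_nonneg_left hI (by linarith)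
      _ = R := by rw [hlam]; field_simp; ring
  have hE := aux_Eex_le W Q R (auxMix lam P) (auxMix_prob hP h0 h1)
    (fun x => by rw [auxMix_fst hP, hQ]) hle
  have hls : lam * √(mutualInfo P) ≤ √δ := by
    have a : √(mutualInfo P) ≤ √(R + δ) := Real.sqrt_le_sqrt hI
    have b : √δ ≤ √(R + δ) := Real.sqrt_le_sqrt (by linarith)
    have c : 0 < √(R + δ) := Real.sqrt_pos.2 hs
    have d : √(R + δ) ^ 2 = R + δ := Real.sq_sqrt hs.le
    have e : √δ ^ 2 = δ := Real.sq_sqrt hδ.le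
    calc lam * √(mutualInfo P) ≤ lam * √(R + δ) := mul_le_mul_of_nonneg_left a h0
      _ ≤ √δ := by
        rw [hlam, div_mul_eq_mul_div, div_le_iff₀ hs]
        have : 0 ≤ √δ := Real.sqrt_nonneg _
        calc δ * √(R + δ) = √δ ^ 2 * √(R + δ) := by rw [e]
          _ ≤ √δ * √(R + δ) ^ 2 := by
            nlinarith [mul_nonneg (mul_nonneg this c.le) (sub_nonneg.2 b)]
          _ = _ := by rw [d]
  have hd : ∑ p : X × X, auxMix lam P p * dB W p.1 p.2 ≤ (∑ p : X × X, P p * dB W p.1 p.2)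
      + 2 * (∑ p : X × X, |dB W p.1 p.2|) * √δ := by
    rw [Finset.mul_sum, Finset.sum_mul, ← Finset.sum_add_distrib]
    apply Finset.sum_le_sum
    intro p _
    have e : auxMix lam P p * dB W p.1 p.2 = P p * dB W p.1 p.2
        + lam * ((auxR P p - P p) * dB W p.1 p.2) := by unfold auxMix; ring
    rw [e]
    have h5 : (auxR P p - P p) * dB W p.1 p.2 ≤ 2 * √(mutualInfo P) * |dB W p.1 p.2| := by
      refine (le_abs_self _).trans ?_
      rw [abs_mul]
      exact mul_le_mul_of_nonneg_right (aux_tv hP p) (abs_nonneg _)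
    have h6 := mul_le_mul_of_nonneg_left h5 h0
    have h7 := mul_le_mul_of_nonneg_right hls (abs_nonneg (dB W p.1 p.2))
    nlinarith
  have : (1 - lam) * mutualInfo P ≤ mutualInfo P := by nlinarith
  linarith

end

lemma aux_KL_bound {V : Type} [Fintype V] (PV Q : V → ℝ) (hQ : IsProbDist Q) :
    |KL Q PV| ≤ ∑ a, (1 + |Real.log (PV a)|) := by
  unfold KL
  refine (Finset.abs_sum_le_sum_abs _ _).trans (Finset.sum_le_sum fun a _ => ?_)
  have h0 := hQ.1 a
  have h1 := aux_le_one hQ a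
  have hn := abs_nonneg (Real.log (PV a))
  rcases h0.eq_or_lt with h | h
  · rw [← h]; simp; linarith
  by_cases hp : PV a = 0
  · simp [hp]
  rw [Real.log_div h.ne' hp, mul_sub]
  refine (abs_sub _ _).trans ?_
  have := Real.abs_log_mul_self_lt (Q a) h h1
  rw [mul_comm] at this
  have h3 : |Q a * Real.log (PV a)| ≤ |Real.log (PV a)| := by
    rw [abs_mul, abs_of_pos h]
    nlinarith
  linarith

lemma aux_srcRel {V : Type} [Fintype V] (PV Q : V → ℝ) (hQ : IsProbDist Q) (t : ℝ) (n k : ℕ)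
    (h1 : (k : ℝ) ≤ t * n) (h2 : t * n ≤ k + 1) :
    (n : ℝ) * (t * srcRel PV (entH Q)) - ∑ a, (1 + |Real.log (PV a)|) ≤ k * KL Q PV := by
  have hb := aux_KL_bound PV Q hQ
  set C := ∑ a, (1 + |Real.log (PV a)|)
  have hs : srcRel PV (entH Q) ≤ KL Q PV := by
    apply csInf_le
    · refine ⟨-C, ?_⟩
      rintro z ⟨Q', hQ', _, rfl⟩
      exact (abs_le.1 (aux_KL_bound PV Q' hQ')).1
    · exact ⟨Q, hQ, le_rfl, rfl⟩
  have hC : 0 ≤ C := (abs_nonneg _).trans hb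
  have hs2 : srcRel PV (entH Q) ≤ C := hs.trans (abs_le.1 hb).2
  have hk : (0 : ℝ) ≤ k := Nat.cast_nonneg k
  have h3 := mul_le_mul_of_nonneg_left hs hk
  nlinarith [mul_nonneg (sub_nonneg.2 h1) (sub_nonneg.2 hs2)]

lemma aux_source_prob {V : Type} [Fintype V] (PV : V → ℝ) (hPV : IsProbDist PV) {k : ℕ}
    (hk : 0 < k) (v : Fin k → V) :
    ∑ w ∈ typeClass k (empDist v), prodDist PV w ≤ Real.exp (-(k * KL (empDist v) PV)) := by
  have h : ∀ w ∈ typeClass k (empDist v), prodDist PV w ≤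
      Real.exp (-(k * entH (empDist v))) * Real.exp (-(k * KL (empDist v) PV)) := by
    intro w hw
    simp only [typeClass, Finset.mem_filter, Finset.mem_univ, true_and] at hw
    rw [← hw]
    by_cases h0 : ∃ i, PV (w i) = 0
    · obtain ⟨i, hi⟩ := h0
      unfold prodDist
      rw [Finset.prod_eq_zero (Finset.mem_univ i) hi]
      positivity
    push Not at h0
    have hpos : ∀ i, 0 < PV (w i) := fun i => lt_of_le_of_ne (hPV.1 _) (h0 i).symm
    rw [← aux_prod_emp, mul_comm]
    have : Real.exp (-(k * KL (empDist w) PV)) = ∏ l, (PV (w l) / empDist w (w l)) := by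
      have e : ∀ l, PV (w l) / empDist w (w l)
          = Real.exp (-Real.log (empDist w (w l) / PV (w l))) := by
        intro l
        rw [← Real.log_inv, inv_div, Real.exp_log (div_pos (hpos l) (aux_emp_pos w l))]
      rw [Finset.prod_congr rfl fun l _ => e l, ← Real.exp_sum, Finset.sum_neg_distrib,
        aux_emp_sum w (fun a => Real.log (empDist w a / PV a))]
      rfl
    rw [this, ← Finset.prod_mul_distrib]
    unfold prodDist
    apply le_of_eq
    apply Finset.prod_congr rfl
    intro l _
    rw [div_mul_cancel₀ _ (aux_emp_pos w l).ne']
  refine (Finset.sum_le_sum h).trans ?_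
  rw [Finset.sum_const, nsmul_eq_mul, ← mul_assoc]
  have h1 := aux_class_upper hk v
  have : ((typeClass k (empDist v)).card : ℝ) * Real.exp (-(k * entH (empDist v))) ≤ 1 := by
    rw [Real.exp_neg, ← div_eq_mul_inv, div_le_one (Real.exp_pos _)]
    exact h1
  exact mul_le_of_le_one_left (Real.exp_pos _).le this

/-- joint type of a pair of sequences -/
def auxJ {X : Type} [Fintype X] {n : ℕ} (x x' : Fin n → X) : X × X → ℝ :=
  empDist (fun l => (x l, x' l))

section
variable {X : Type} [Fintype X] {n : ℕ}

lemma auxJ_fst (hn : 0 < n) (x x' : Fin n → X) (a : X) :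
    ∑ b, auxJ x x' (a, b) = empDist x a := by
  have h1 := aux_emp_sum (fun l => (x l, x' l)) (fun p => if p.1 = a then (1 : ℝ) else 0)
  have h2 := aux_emp_sum x (fun b => if b = a then (1 : ℝ) else 0)
  simp only at h1
  rw [h1] at h2
  have hn' : (n : ℝ) ≠ 0 := by positivity
  have h3 := mul_left_cancel₀ hn' h2
  rw [Fintype.sum_prod_type_right] at h3
  simpa [auxJ] using h3

lemma auxJ_snd (hn : 0 < n) (x x' : Fin n → X) (b : X) :
    ∑ a, auxJ x x' (a, b) = empDist x' b := by
  have h1 := aux_emp_sum (fun l => (x l, x' l)) (fun p => if p.2 = b then (1 : ℝ) else 0)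
  have h2 := aux_emp_sum x' (fun c => if c = b then (1 : ℝ) else 0)
  simp only at h1
  rw [h1] at h2
  have hn' : (n : ℝ) ≠ 0 := by positivity
  have h3 := mul_left_cancel₀ hn' h2
  rw [Fintype.sum_prod_type] at h3
  simpa [auxJ] using h3

lemma auxJ_swap (x x' : Fin n → X) (a b : X) : auxJ x' x (a, b) = auxJ x x' (b, a) := by
  unfold auxJ empDist
  simp only [Prod.mk.injEq]
  congr 3
  ext i
  simp [and_comm]

lemma auxJ_mi_swap (x x' : Fin n → X) : mutualInfo (auxJ x' x) = mutualInfo (auxJ x x') := by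
  unfold mutualInfo
  rw [Fintype.sum_prod_type, Fintype.sum_prod_type_right]
  simp only [auxJ_swap x x']
  refine Finset.sum_congr rfl fun a _ => Finset.sum_congr rfl fun b _ => ?_
  rw [mul_comm (∑ x_1, auxJ x x' (x_1, a))]

lemma auxJ_exp (hn : 0 < n) (x x' : Fin n → X) :
    Real.exp (n * mutualInfo (auxJ x x')) =
      Real.exp (n * entH (empDist x)) *
        ∏ l, (auxJ x x' (x l, x' l) / ∑ a, auxJ x x' (a, x' l)) := by
  have hz := fun l => aux_emp_pos (fun l => (x l, x' l)) l
  have h1 : Real.exp (n * mutualInfo (auxJ x x')) =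
      ∏ l, (auxJ x x' (x l, x' l) / (empDist x (x l) * empDist x' (x' l))) := by
    have e := aux_emp_sum (fun l => (x l, x' l))
      (fun p => Real.log (auxJ x x' p / auxR (auxJ x x') p))
    rw [aux_mi_eq]
    unfold auxJ at e ⊢
    rw [← e, Real.exp_sum]
    apply Finset.prod_congr rfl
    intro l _
    have h3 : auxR (empDist fun l => (x l, x' l)) (x l, x' l)
        = empDist x (x l) * empDist x' (x' l) := by
      unfold auxR
      rw [← auxJ_fst hn x x', ← auxJ_snd hn x x']
      rfl
    rw [h3, Real.exp_log]
    exact div_pos (hz l) (mul_pos (aux_emp_pos x l) (aux_emp_pos x' l))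
  have h2 : Real.exp (n * entH (empDist x)) = ∏ l, (empDist x (x l))⁻¹ := by
    rw [Finset.prod_inv_distrib, aux_prod_emp, Real.exp_neg, inv_inv]
  rw [h1, h2, ← Finset.prod_mul_distrib]
  apply Finset.prod_congr rfl
  intro l _
  rw [auxJ_snd hn]
  have := (aux_emp_pos x l).ne'
  have := (aux_emp_pos x' l).ne'
  field_simp

lemma aux_avg (hn : 0 < n) (Q : X → ℝ) (hQ : IsType n Q) (x' : Fin n → X) :
    ∑ x ∈ typeClass n Q, Real.exp (n * mutualInfo (auxJ x x')) ≤
      (((n : ℝ) + 1) ^ Fintype.card (X × X) * ((n : ℝ) + 1) ^ Fintype.card X)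
        * (typeClass n Q).card := by
  obtain ⟨x0, rfl⟩ := hQ
  have hJ := aux_num_types n (Finset.univ : Finset (Fin n → X × X))
  set J := (Finset.univ : Finset (Fin n → X × X)).image empDist with hJdef
  let F : (X × X → ℝ) → (Fin n → X) → ℝ := fun P x => ∏ l, (P (x l, x' l) / ∑ a, P (a, x' l))
  have hJn : ∀ P ∈ J, ∀ p, 0 ≤ P p := by
    intro P hP p
    simp only [hJdef, Finset.mem_image, Finset.mem_univ, true_and] at hP
    obtain ⟨z, rfl⟩ := hP
    exact aux_emp_nonneg z p
  have hF0 : ∀ P ∈ J, ∀ x, 0 ≤ F P x := by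
    intro P hP x
    exact Finset.prod_nonneg fun l _ =>
      div_nonneg (hJn P hP _) (Finset.sum_nonneg fun _ _ => hJn P hP _)
  have hF1 : ∀ P ∈ J, ∑ x, F P x ≤ 1 := by
    intro P hP
    simp only [F]
    rw [← Fintype.prod_sum (fun l a => P (a, x' l) / ∑ a, P (a, x' l))]
    apply Finset.prod_le_one
    · intro l _
      exact Finset.sum_nonneg fun a _ =>
        div_nonneg (hJn P hP _) (Finset.sum_nonneg fun _ _ => hJn P hP _)
    · intro l _
      rw [← Finset.sum_div]
      exact div_self_le_one _
  have h1 : ∀ x ∈ typeClass n (empDist x0), Real.exp (n * mutualInfo (auxJ x x')) ≤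
      Real.exp (n * entH (empDist x0)) * ∑ P ∈ J, F P x := by
    intro x hx
    simp only [typeClass, Finset.mem_filter, Finset.mem_univ, true_and] at hx
    rw [auxJ_exp hn, hx]
    apply mul_le_mul_of_nonneg_left _ (Real.exp_pos _).le
    exact Finset.single_le_sum (f := fun P => F P x) (fun P hP => hF0 P hP x)
      (Finset.mem_image_of_mem _ (Finset.mem_univ _))
  have h2 : ∑ x ∈ typeClass n (empDist x0), ∑ P ∈ J, F P x ≤ J.card := by
    calc _ ≤ ∑ x, ∑ P ∈ J, F P x :=
          Finset.sum_le_sum_of_subset_of_nonneg (Finset.subset_univ _)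
            fun x _ _ => Finset.sum_nonneg fun P hP => hF0 P hP x
      _ = ∑ P ∈ J, ∑ x, F P x := Finset.sum_comm
      _ ≤ ∑ P ∈ J, 1 := Finset.sum_le_sum hF1
      _ = _ := by simp
  calc _ ≤ ∑ x ∈ typeClass n (empDist x0),
        Real.exp (n * entH (empDist x0)) * ∑ P ∈ J, F P x := Finset.sum_le_sum h1
    _ = Real.exp (n * entH (empDist x0)) * ∑ x ∈ typeClass n (empDist x0), ∑ P ∈ J, F P x := by
        rw [Finset.mul_sum]
    _ ≤ (((n : ℝ) + 1) ^ Fintype.card X * (typeClass n (empDist x0)).card) *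
          ((n : ℝ) + 1) ^ Fintype.card (X × X) :=
        mul_le_mul (aux_class_lower hn x0) (h2.trans hJ)
          (Finset.sum_nonneg fun x _ => Finset.sum_nonneg fun P hP => hF0 P hP x)
          (by positivity)
    _ = _ := by ring

end

lemma aux_split {S : Type} [Fintype S] [DecidableEq S] (s : S) (h : S → S → ℝ) :
    ∑ u, ∑ u', h u u' = (∑ u', h s u') + ((∑ u ∈ Finset.univ.erase s, h u s) +
      ∑ u ∈ Finset.univ.erase s, ∑ u' ∈ Finset.univ.erase s, h u u') := by
  rw [← Finset.add_sum_erase Finset.univ _ (Finset.mem_univ s), ← Finset.sum_add_distrib]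
  congr 1
  apply Finset.sum_congr rfl
  intro u _
  rw [Finset.add_sum_erase Finset.univ _ (Finset.mem_univ s)]

lemma aux_opt {S Z : Type} [Fintype S] [DecidableEq S] [Fintype Z] (T : S → Finset Z) (hT : ∀ s, (T s).Nonempty)
    (w : S → ℝ) (hw : ∀ s, 0 < w s) (G : Z → Z → ℝ) (hG : ∀ z z', G z z' = G z' z)
    (C : ℝ) (hC0 : 0 ≤ C)
    (hC : ∀ s z', ∑ z ∈ T s, G z z' ≤ C * (T s).card) :
    ∃ f : S → Z, (∀ s, f s ∈ T s) ∧
      ∀ s, ∑ s' ∈ Finset.univ.erase s, w s' * G (f s) (f s') ≤ C * ∑ s', w s' := by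
  let H : (S → Z) → S → S → ℝ := fun f u u' => if u = u' then 0 else w u * w u' * G (f u) (f u')
  obtain ⟨f, hf, hmin⟩ := Finset.exists_min_image (Fintype.piFinset T)
    (fun f => ∑ u, ∑ u', H f u u') (by
      rw [Fintype.piFinset_nonempty]; exact hT)
  rw [Fintype.mem_piFinset] at hf
  refine ⟨f, hf, fun s => ?_⟩
  have hrow : ∀ g : S → Z, ∑ u', H g s u' =
      w s * ∑ u' ∈ Finset.univ.erase s, w u' * G (g s) (g u') := by
    intro g
    rw [← Finset.add_sum_erase Finset.univ _ (Finset.mem_univ s), Finset.mul_sum]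
    simp only [H, if_true, zero_add]
    apply Finset.sum_congr rfl
    intro u hu
    rw [if_neg (Finset.ne_of_mem_erase hu).symm, mul_assoc]
  have hcol : ∀ g : S → Z, ∑ u ∈ Finset.univ.erase s, H g u s =
      w s * ∑ u' ∈ Finset.univ.erase s, w u' * G (g s) (g u') := by
    intro g
    rw [Finset.mul_sum]
    apply Finset.sum_congr rfl
    intro u hu
    simp only [H]
    rw [if_neg (Finset.ne_of_mem_erase hu), hG]
    ring
  have hloc : ∀ z ∈ T s, ∑ s' ∈ Finset.univ.erase s, w s' * G (f s) (f s') ≤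
      ∑ s' ∈ Finset.univ.erase s, w s' * G z (f s') := by
    intro z hz
    have hm := hmin (Function.update f s z) (by
      rw [Fintype.mem_piFinset]
      intro u
      by_cases hu : u = s
      · subst hu; simpa using hz
      · rw [Function.update_of_ne hu]; exact hf u)
    rw [aux_split s, aux_split s (H (Function.update f s z)), hrow, hrow, hcol, hcol] at hm
    have e1 : ∑ u' ∈ Finset.univ.erase s,
        w u' * G (Function.update f s z s) (Function.update f s z u') =
        ∑ s' ∈ Finset.univ.erase s, w s' * G z (f s') := by
      apply Finset.sum_congr rfl
      intro u hu
      rw [Function.update_self, Function.update_of_ne (Finset.ne_of_mem_erase hu)]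
    have e2 : ∑ u ∈ Finset.univ.erase s, ∑ u' ∈ Finset.univ.erase s,
        H (Function.update f s z) u u' =
        ∑ u ∈ Finset.univ.erase s, ∑ u' ∈ Finset.univ.erase s, H f u u' := by
      apply Finset.sum_congr rfl
      intro u hu
      apply Finset.sum_congr rfl
      intro u' hu'
      simp only [H]
      rw [Function.update_of_ne (Finset.ne_of_mem_erase hu),
        Function.update_of_ne (Finset.ne_of_mem_erase hu')]
    rw [e1, e2] at hm
    have := hw s
    by_contra hcon
    push Not at hcon
    nlinarith [mul_lt_mul_of_pos_left hcon this]
  have hsum := Finset.sum_le_sum hloc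
  rw [Finset.sum_const, nsmul_eq_mul, Finset.sum_comm] at hsum
  have hcard : (0 : ℝ) < (T s).card := by exact_mod_cast Finset.card_pos.2 (hT s)
  have h3 : ∑ y ∈ Finset.univ.erase s, ∑ x ∈ T s, w y * G x (f y) ≤
      (T s).card * (C * ∑ s', w s') := by
    calc _ ≤ ∑ y ∈ Finset.univ.erase s, w y * (C * (T s).card) := by
          apply Finset.sum_le_sum
          intro y _
          rw [← Finset.mul_sum]
          exact mul_le_mul_of_nonneg_left (hC s (f y)) (hw y).le
      _ ≤ ∑ y, w y * (C * (T s).card) :=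
          Finset.sum_le_sum_of_subset_of_nonneg (Finset.subset_univ _)
            fun y _ _ => mul_nonneg (hw y).le (by positivity)
      _ = _ := by rw [← Finset.sum_mul]; ring
  exact le_of_mul_le_mul_left (hsum.trans h3) hcard

lemma aux_growth (c : ℝ) (hc : 0 < c) (p : ℕ) (δ : ℝ) (hδ : 0 < δ) :
    ∀ᶠ n : ℕ in Filter.atTop, (c * n + 1) ^ p ≤ Real.exp (n * δ) := by
  have hb : 0 < δ / c := by positivity
  have h := (isLittleO_pow_exp_pos_mul_atTop p hb).def (Real.exp_pos (-(δ / c)))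
  have ht : Filter.Tendsto (fun n : ℕ => c * (n : ℝ) + 1) Filter.atTop Filter.atTop :=
    Filter.tendsto_atTop_add_const_right _ _
      (tendsto_natCast_atTop_atTop.const_mul_atTop hc)
  filter_upwards [ht.eventually h] with n hn
  rw [Real.norm_eq_abs, Real.norm_eq_abs, abs_of_nonneg (by positivity),
    abs_of_pos (Real.exp_pos _), ← Real.exp_add] at hn
  refine hn.trans (le_of_eq ?_)
  congr 1
  field_simp
  ring

lemma aux_map {V X Y : Type} [Fintype V] [Fintype X] [Fintype Y] [Nonempty V] (PV : V → ℝ)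
    (hPV : IsProbDist PV) (W : X → Y → ℝ) (hW : IsDMC W) {k n : ℕ}
    (f : (Fin k → V) → Fin n → X) :
    ∃ φ : (Fin n → Y) → Fin k → V, pErr PV W f φ ≤
      ∑ v, ∑ v' ∈ Finset.univ.erase v, √(prodDist PV v * prodDist PV v') *
        ∏ l, ∑ y, √(W (f v l) y * W (f v' l) y) := by
  have hP0 : ∀ v : Fin k → V, 0 ≤ prodDist PV v := fun v =>
    Finset.prod_nonneg fun _ _ => hPV.1 _
  have hW0 : ∀ (x : Fin n → X) (y : Fin n → Y), 0 ≤ Wn W x y := fun x y =>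
    Finset.prod_nonneg fun _ _ => hW.1 _ _
  choose φ hφ using fun y : Fin n → Y =>
    Finite.exists_max (fun v : Fin k → V => prodDist PV v * Wn W (f v) y)
  refine ⟨φ, ?_⟩
  unfold pErr
  apply Finset.sum_le_sum
  intro v _
  have hprod : ∀ v' : Fin k → V, ∏ l, ∑ y, √(W (f v l) y * W (f v' l) y) =
      ∑ y : Fin n → Y, √(Wn W (f v) y * Wn W (f v') y) := by
    intro v'
    rw [Fintype.prod_sum]
    apply Finset.sum_congr rfl
    intro y _
    unfold Wn
    rw [← Finset.prod_mul_distrib, Real.sqrt_prod]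
    intro l _
    exact mul_nonneg (hW.1 _ _) (hW.1 _ _)
  simp only [hprod, Finset.mul_sum]
  rw [Finset.sum_comm (s := Finset.univ.erase v)]
  calc _ ≤ ∑ y with φ y ≠ v, ∑ v' ∈ Finset.univ.erase v,
        √(prodDist PV v * prodDist PV v') * √(Wn W (f v) y * Wn W (f v') y) := by
        apply Finset.sum_le_sum
        intro y hy
        simp only [Finset.mem_filter, Finset.mem_univ, true_and] at hy
        have h1 : prodDist PV v * Wn W (f v) y ≤ √(prodDist PV v * prodDist PV (φ y)) *
            √(Wn W (f v) y * Wn W (f (φ y)) y) := by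
          rw [← Real.sqrt_mul (mul_nonneg (hP0 _) (hP0 _))]
          apply Real.le_sqrt_of_sq_le
          have a := hφ y v
          have b := mul_nonneg (hP0 v) (hW0 (f v) y)
          nlinarith [mul_le_mul_of_nonneg_left a b]
        refine h1.trans ?_
        exact Finset.single_le_sum (f := fun v' => √(prodDist PV v * prodDist PV v') *
            √(Wn W (f v) y * Wn W (f v') y)) (fun _ _ => by positivity)
            (Finset.mem_erase.2 ⟨hy, Finset.mem_univ _⟩)
    _ ≤ _ := Finset.sum_le_sum_of_subset_of_nonneg (Finset.subset_univ _)
        fun y _ _ => Finset.sum_nonneg fun v' _ => by positivity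

lemma aux_bhat {X Y : Type} [Fintype X] [Fintype Y] (W : X → Y → ℝ) {n : ℕ}
    (x x' : Fin n → X) :
    ∏ l, ∑ y, √(W (x l) y * W (x' l) y) ≤
      Real.exp (-(n * ∑ p : X × X, auxJ x x' p * dB W p.1 p.2)) := by
  have h := aux_emp_sum (fun l => (x l, x' l)) (fun p => dB W p.1 p.2)
  unfold auxJ
  rw [← h, ← Finset.sum_neg_distrib, Real.exp_sum]
  apply Finset.prod_le_prod
  · intro l _
    exact Finset.sum_nonneg fun _ _ => Real.sqrt_nonneg _
  · intro l _
    unfold dB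
    rw [neg_neg]
    exact Real.le_exp_log _

lemma aux_symm {S : Type} [Fintype S] [DecidableEq S] (p N : S → ℝ) (hp : ∀ s, 0 ≤ p s) (hN : ∀ s, 0 < N s)
    (B : S → S → ℝ) (hB : ∀ s s', B s s' = B s' s) (hB0 : ∀ s s', 0 ≤ B s s') :
    ∑ v, ∑ v' ∈ Finset.univ.erase v, √(p v * p v') * B v v' ≤
      ∑ v, p v * N v * ∑ v' ∈ Finset.univ.erase v, (N v')⁻¹ * B v v' := by
  have hs : ∀ v v', √(p v * p v') ≤ (p v * N v * (N v')⁻¹ + p v' * N v' * (N v)⁻¹) / 2 := by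
    intro v v'
    have a := hp v
    have b := hp v'
    have c := hN v
    have d := hN v'
    have e : p v * p v' = (p v * N v * (N v')⁻¹) * (p v' * N v' * (N v)⁻¹) := by
      field_simp
    rw [e]
    apply Real.sqrt_le_iff.2
    constructor
    · positivity
    · nlinarith [sq_nonneg (p v * N v * (N v')⁻¹ - p v' * N v' * (N v)⁻¹)]
  have conv : ∀ g : S → S → ℝ, ∑ v, ∑ v' ∈ Finset.univ.erase v, g v v' =
      ∑ v, ∑ v', if v = v' then 0 else g v v' := by
    intro g
    apply Finset.sum_congr rfl
    intro v _
    rw [← Finset.add_sum_erase Finset.univ (fun v' => if v = v' then 0 else g v v')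
      (Finset.mem_univ v)]
    simp only [if_true, zero_add]
    apply Finset.sum_congr rfl
    intro u hu
    rw [if_neg (Finset.ne_of_mem_erase hu).symm]
  have hsw : ∑ v, ∑ v' ∈ Finset.univ.erase v, p v' * N v' * (N v)⁻¹ * B v v' =
      ∑ v, ∑ v' ∈ Finset.univ.erase v, p v * N v * (N v')⁻¹ * B v v' := by
    rw [conv, conv, Finset.sum_comm]
    refine Finset.sum_congr rfl fun a _ => Finset.sum_congr rfl fun b _ => ?_
    rw [hB b a]
    simp only [eq_comm]
  calc _ ≤ ∑ v, ∑ v' ∈ Finset.univ.erase v,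
        (p v * N v * (N v')⁻¹ * B v v' / 2 + p v' * N v' * (N v)⁻¹ * B v v' / 2) := by
        refine Finset.sum_le_sum fun v _ => Finset.sum_le_sum fun v' _ => ?_
        have := mul_le_mul_of_nonneg_right (hs v v') (hB0 v v')
        linarith
    _ = ∑ v, ∑ v' ∈ Finset.univ.erase v, p v * N v * (N v')⁻¹ * B v v' := by
        simp only [Finset.sum_add_distrib, ← Finset.sum_div]
        rw [hsw]; ring
    _ = _ := by
        refine Finset.sum_congr rfl fun v _ => ?_
        rw [Finset.mul_sum]
        refine Finset.sum_congr rfl fun v' _ => ?_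
        ring

lemma aux_sum_inv {V : Type} [Fintype V] (k : ℕ) :
    ∑ v : Fin k → V, ((typeClass k (empDist v)).card : ℝ)⁻¹ ≤
      ((k : ℝ) + 1) ^ Fintype.card V := by
  refine le_trans ?_ (aux_num_types k (Finset.univ : Finset (Fin k → V)))
  rw [← Finset.sum_fiberwise_of_maps_to (g := empDist) (t := Finset.univ.image empDist)
    (fun i _ => Finset.mem_image_of_mem _ (Finset.mem_univ i)), Finset.card_eq_sum_ones]
  push_cast
  apply Finset.sum_le_sum
  intro P _
  have : ∀ v ∈ (Finset.univ.filter fun v : Fin k → V => empDist v = P),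
      ((typeClass k (empDist v)).card : ℝ)⁻¹ = ((typeClass k P).card : ℝ)⁻¹ := by
    intro v hv
    simp only [Finset.mem_filter, Finset.mem_univ, true_and] at hv
    rw [hv]
  rw [Finset.sum_congr rfl this, Finset.sum_const, nsmul_eq_mul]
  exact mul_inv_le_one

lemma aux_ent_nonneg {α : Type} [Fintype α] {P : α → ℝ} (hP : IsProbDist P) : 0 ≤ entH P := by
  unfold entH
  rw [← Finset.sum_neg_distrib]
  refine Finset.sum_nonneg fun a _ => ?_
  have := Real.log_nonpos (hP.1 a) (aux_le_one hP a)
  nlinarith [hP.1 a]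

lemma aux_core {V X Y : Type} [Fintype V] [Fintype X] [Fintype Y] [Nonempty V]
    (PV : V → ℝ) (hPV : IsProbDist PV) (W : X → Y → ℝ) (hW : IsDMC W)
    (t δ ε₁ ε₂ : ℝ) (ht : 0 < t) (hδ : 0 < δ)
    (hε₁ : 2 * (∑ p : X × X, |dB W p.1 p.2|) * √δ ≤ ε₁)
    (n k m : ℕ) (hn : 0 < n) (hk : 0 < k) (hk1 : (k : ℝ) ≤ t * n) (hk2 : t * n ≤ k + 1)
    (hK : (((n : ℝ) + 1) ^ Fintype.card (X × X) * ((n : ℝ) + 1) ^ Fintype.card X) *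
      ((k : ℝ) + 1) ^ Fintype.card V ≤ Real.exp (n * δ))
    (hC : ∑ a, (1 + |Real.log (PV a)|) ≤ n * ε₂)
    (cls : (Fin k → V) → Fin m) (Qc : Fin m → X → ℝ) (hA : AdmissiblePartition n cls Qc) :
    ∃ (f : (Fin k → V) → Fin n → X) (φ : (Fin n → Y) → Fin k → V),
      pErr PV W f φ ≤ Real.exp ((n : ℝ) * (δ + ε₁ + ε₂)) *
        ∑ c : Fin m, ∑ Pi ∈ classTypes cls c,
          Real.exp (-(n : ℝ) * (t * srcRel PV (entH Pi) + Eex' W (Qc c) (t * entH Pi))) := by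
  obtain ⟨hA1, hA2, -⟩ := hA
  have hn' : (0 : ℝ) < n := by exact_mod_cast hn
  set N : (Fin k → V) → ℝ := fun v => ((typeClass k (empDist v)).card : ℝ) with hNdef
  have hN : ∀ v, 0 < N v := by
    intro v
    have : 0 < (typeClass k (empDist v)).card :=
      Finset.card_pos.2 ⟨v, by simp [typeClass]⟩
    exact Nat.cast_pos.2 this
  have hNR : ∀ v, N v ≤ Real.exp (n * (t * entH (empDist v))) := by
    intro v
    refine (aux_class_upper hk v).trans (Real.exp_le_exp.2 ?_)
    have := aux_ent_nonneg (aux_emp_prob hk v)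
    nlinarith
  obtain ⟨f, hf, hA⟩ := aux_opt (fun v => typeClass n (Qc (cls v)))
    (fun v => by
      obtain ⟨x, hx⟩ := hA2 (cls v)
      exact ⟨x, by simp [typeClass, hx]⟩)
    (fun v => (N v)⁻¹) (fun v => inv_pos.2 (hN v))
    (fun x x' => Real.exp (n * mutualInfo (auxJ x x')))
    (fun x x' => by rw [auxJ_mi_swap])
    (((n : ℝ) + 1) ^ Fintype.card (X × X) * ((n : ℝ) + 1) ^ Fintype.card X)
    (by positivity)
    (fun v x' => aux_avg hn _ (hA2 (cls v)) x')
  have hA' : ∀ v, ∑ v' ∈ Finset.univ.erase v,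
      (N v')⁻¹ * Real.exp (n * mutualInfo (auxJ (f v) (f v'))) ≤ Real.exp (n * δ) := by
    intro v
    refine (hA v).trans (le_trans ?_ hK)
    exact mul_le_mul_of_nonneg_left (aux_sum_inv k) (by positivity)
  have hfst : ∀ v v' x, ∑ x', auxJ (f v) (f v') (x, x') = Qc (cls v) x := by
    intro v v' x
    rw [auxJ_fst hn]
    have := hf v
    simp only [typeClass, Finset.mem_filter, Finset.mem_univ, true_and] at this
    rw [this]
  have hI : ∀ v v', v' ≠ v → mutualInfo (auxJ (f v) (f v')) ≤ t * entH (empDist v) + δ := by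
    intro v v' hne
    have h1 : (N v)⁻¹ * Real.exp (n * mutualInfo (auxJ (f v') (f v))) ≤ Real.exp (n * δ) :=
      le_trans (Finset.single_le_sum
        (f := fun u => (N u)⁻¹ * Real.exp (n * mutualInfo (auxJ (f v') (f u))))
        (fun u _ => mul_nonneg (inv_nonneg.2 (hN u).le) (Real.exp_pos _).le)
        (Finset.mem_erase.2 ⟨hne.symm, Finset.mem_univ v⟩)) (hA' v')
    rw [auxJ_mi_swap, inv_mul_le_iff₀ (hN v)] at h1
    have h2 := h1.trans (mul_le_mul_of_nonneg_right (hNR v) (Real.exp_pos _).le)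
    rw [← Real.exp_add, Real.exp_le_exp, ← mul_add] at h2
    exact le_of_mul_le_mul_left h2 hn'
  obtain ⟨φ, hφ⟩ := aux_map PV hPV W hW f
  refine ⟨f, φ, hφ.trans ?_⟩
  have hP0 : ∀ v : Fin k → V, 0 ≤ prodDist PV v := fun v =>
    Finset.prod_nonneg fun _ _ => hPV.1 _
  refine (aux_symm (fun v => prodDist PV v) N hP0 hN
    (fun v v' => ∏ l, ∑ y, √(W (f v l) y * W (f v' l) y))
    (fun v v' => by simp only [mul_comm])
    (fun v v' => Finset.prod_nonneg fun _ _ => Finset.sum_nonneg fun _ _ =>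
      Real.sqrt_nonneg _)).trans ?_
  let E : (Fin k → V) → ℝ := fun v => Eex' W (Qc (cls v)) (t * entH (empDist v))
  have hv : ∀ v, prodDist PV v * N v * ∑ v' ∈ Finset.univ.erase v,
      (N v')⁻¹ * ∏ l, ∑ y, √(W (f v l) y * W (f v' l) y) ≤
      prodDist PV v * Real.exp (n * (δ + ε₁) - n * E v) := by
    intro v
    rw [mul_assoc]
    apply mul_le_mul_of_nonneg_left _ (hP0 v)
    have h1 : ∀ v' ∈ Finset.univ.erase v,
        (N v')⁻¹ * ∏ l, ∑ y, √(W (f v l) y * W (f v' l) y) ≤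
        ((N v')⁻¹ * Real.exp (n * mutualInfo (auxJ (f v) (f v')))) *
          Real.exp (n * (ε₁ - E v - t * entH (empDist v))) := by
      intro v' hv'
      rw [mul_assoc]
      apply mul_le_mul_of_nonneg_left _ (inv_nonneg.2 (hN v').le)
      refine (aux_bhat W (f v) (f v')).trans ?_
      rw [← Real.exp_add, Real.exp_le_exp, ← mul_add, ← mul_neg]
      apply mul_le_mul_of_nonneg_left _ hn'.le
      have := aux_Eex_cont W (Qc (cls v)) (t * entH (empDist v)) δ
        (mul_nonneg ht.le (aux_ent_nonneg (aux_emp_prob hk v))) hδ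
        (auxJ (f v) (f v')) (aux_emp_prob hn _) (hfst v v')
        (hI v v' (Finset.ne_of_mem_erase hv'))
      simp only [E]
      linarith
    have h2 := Finset.sum_le_sum h1
    rw [← Finset.sum_mul] at h2
    have h3 := h2.trans (mul_le_mul_of_nonneg_right (hA' v) (Real.exp_pos _).le)
    calc _ ≤ Real.exp (n * (t * entH (empDist v))) * (Real.exp (n * δ) *
          Real.exp (n * (ε₁ - E v - t * entH (empDist v)))) :=
          mul_le_mul (hNR v) h3 (Finset.sum_nonneg fun v' _ =>
            mul_nonneg (inv_nonneg.2 (hN v').le) (Finset.prod_nonneg fun _ _ =>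
              Finset.sum_nonneg fun _ _ => Real.sqrt_nonneg _)) (Real.exp_pos _).le
      _ = _ := by
          rw [← Real.exp_add, ← Real.exp_add]
          congr 1
          ring
  refine (Finset.sum_le_sum fun v _ => hv v).trans ?_
  rw [← Finset.sum_fiberwise Finset.univ cls, Finset.mul_sum]
  apply Finset.sum_le_sum
  intro c _
  rw [← Finset.sum_fiberwise_of_maps_to (g := empDist) (t := classTypes cls c)
    (fun v hv => Finset.mem_image_of_mem _ hv), Finset.mul_sum]
  apply Finset.sum_le_sum
  intro Pi hPi
  simp only [classTypes, Finset.mem_image, Finset.mem_filter, Finset.mem_univ, true_and] at hPi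
  obtain ⟨v, hvc, rfl⟩ := hPi
  have h1 : ∀ w ∈ (Finset.univ.filter fun w => cls w = c).filter
      (fun w => empDist w = empDist v),
      prodDist PV w * Real.exp (n * (δ + ε₁) - n * E w) =
      prodDist PV w * Real.exp (n * (δ + ε₁) -
        n * Eex' W (Qc c) (t * entH (empDist v))) := by
    intro w hw
    simp only [Finset.mem_filter, Finset.mem_univ, true_and] at hw
    simp only [E]
    rw [hw.1, hw.2]
  rw [Finset.sum_congr rfl h1, ← Finset.sum_mul]
  have h2 : ∑ w ∈ (Finset.univ.filter fun w => cls w = c).filter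
      (fun w => empDist w = empDist v), prodDist PV w ≤
      ∑ w ∈ typeClass k (empDist v), prodDist PV w := by
    apply Finset.sum_le_sum_of_subset_of_nonneg
    · intro w hw
      simp only [Finset.mem_filter, Finset.mem_univ, true_and] at hw
      simp only [typeClass, Finset.mem_filter, Finset.mem_univ, true_and]
      exact hw.2
    · intro w _ _
      exact hP0 w
  have h3 := aux_srcRel PV (empDist v) (aux_emp_prob hk v) t n k hk1 hk2
  calc _ ≤ Real.exp (-(k * KL (empDist v) PV)) * Real.exp (n * (δ + ε₁) -
        n * Eex' W (Qc c) (t * entH (empDist v))) :=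
        mul_le_mul_of_nonneg_right (h2.trans (aux_source_prob PV hPV hk v)) (Real.exp_pos _).le
    _ ≤ _ := by
        rw [← Real.exp_add, ← Real.exp_add, Real.exp_le_exp]
        linarith

/-- Lemma 2, primal domain: for every admissible partition with
compositions `Q_c`, there exists a joint source-channel code whose error probability is
bounded by `e^{nε} Σ_c Σ_{Pᵢ ∈ Λ_c} exp(-n[t e(H(Pᵢ), P_V) + E'_ex(Q_c, t H(Pᵢ))])`. -/
theorem stmt0 {V X Y : Type} [Fintype V] [Fintype X] [Fintype Y]
    (PV : V → ℝ) (hPV : IsProbDist PV) (W : X → Y → ℝ) (hW : IsDMC W)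
    (t : ℝ) (ht : 0 < t) (ε : ℝ) (hε : 0 < ε) :
    ∃ n₀ : ℕ, ∀ n : ℕ, n₀ ≤ n →
      ∀ (m : ℕ) (cls : (Fin ⌊t * (n : ℝ)⌋₊ → V) → Fin m) (Qc : Fin m → X → ℝ),
        AdmissiblePartition n cls Qc →
        ∃ (f : (Fin ⌊t * (n : ℝ)⌋₊ → V) → Fin n → X)
          (φ : (Fin n → Y) → Fin ⌊t * (n : ℝ)⌋₊ → V),
          pErr PV W f φ ≤ Real.exp ((n : ℝ) * ε) *
            ∑ c : Fin m, ∑ Pi ∈ classTypes cls c,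
              Real.exp (-(n : ℝ) * (t * srcRel PV (entH Pi) +
                Eex' W (Qc c) (t * entH Pi))) := by

  have : Nonempty V := by
    by_contra h
    rw [not_nonempty_iff] at h
    have := hPV.2
    simp at this
  set D := 2 * (∑ p : X × X, |dB W p.1 p.2|) with hD
  have hD0 : 0 ≤ D := by positivity
  obtain ⟨δ, hδ, hδε, hDδ⟩ : ∃ δ : ℝ, 0 < δ ∧ δ ≤ ε / 4 ∧ D * √δ ≤ ε / 4 := by
    refine ⟨min (ε / 4) ((ε / 4 / (D + 1)) ^ 2), by positivity, min_le_left _ _, ?_⟩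
    have : √(min (ε / 4) ((ε / 4 / (D + 1)) ^ 2)) ≤ ε / 4 / (D + 1) := by
      rw [← Real.sqrt_sq (by positivity : 0 ≤ ε / 4 / (D + 1))]
      apply Real.sqrt_le_sqrt
      rw [Real.sqrt_sq (by positivity)]
      exact min_le_right _ _
    refine (mul_le_mul_of_nonneg_left this hD0).trans ?_
    rw [mul_div_assoc', div_le_iff₀ (by positivity)]
    nlinarith
  have g1 := aux_growth 1 one_pos (Fintype.card (X × X) + Fintype.card X) (δ / 2) (by positivity)
  have g2 := aux_growth t ht (Fintype.card V) (δ / 2) (by positivity)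
  have g3 : ∀ᶠ n : ℕ in Filter.atTop, (1 : ℝ) ≤ t * n :=
    (tendsto_natCast_atTop_atTop.const_mul_atTop ht).eventually_ge_atTop 1
  have g4 : ∀ᶠ n : ℕ in Filter.atTop, ∑ a, (1 + |Real.log (PV a)|) ≤ n * (ε / 4) :=
    (tendsto_natCast_atTop_atTop.atTop_mul_const (by positivity)).eventually_ge_atTop _
  obtain ⟨n₀, hn₀⟩ := Filter.eventually_atTop.1
    (g1.and (g2.and (g3.and (g4.and (Filter.eventually_gt_atTop 0)))))
  refine ⟨n₀, fun n hn m cls Qc hA => ?_⟩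
  obtain ⟨h1, h2, h3, h4, hn0⟩ := hn₀ n hn
  have hk : 0 < ⌊t * (n : ℝ)⌋₊ := Nat.floor_pos.2 h3
  have hk1 : ((⌊t * (n : ℝ)⌋₊ : ℕ) : ℝ) ≤ t * n := Nat.floor_le (by positivity)
  have hk2 : t * n ≤ (⌊t * (n : ℝ)⌋₊ : ℕ) + 1 := (Nat.lt_floor_add_one _).le
  obtain ⟨f, φ, h⟩ := aux_core PV hPV W hW t δ (ε / 4) (ε / 4) ht hδ hDδ n _ m hn0 hk hk1 hk2
    (by
      rw [← pow_add, show (n : ℝ) * δ = n * (δ / 2) + n * (δ / 2) by ring, Real.exp_add]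
      rw [one_mul] at h1
      apply mul_le_mul h1 _ (by positivity) (Real.exp_pos _).le
      refine le_trans ?_ h2
      gcongr) h4 cls Qc hA
  refine ⟨f, φ, h.trans ?_⟩
  apply mul_le_mul_of_nonneg_right
  · rw [Real.exp_le_exp]
    apply mul_le_mul_of_nonneg_left _ (Nat.cast_nonneg n)
    linarith
  · exact Finset.sum_nonneg fun c _ => Finset.sum_nonneg fun P _ => (Real.exp_pos _).le

end
end

section
/- For every transmission rate t > 0 and every ε > 0 there exists n₀ such that for all n ≥ n₀ the following holds with k = ⌊tn⌋: for every admissible partition 𝒜₁, …, 𝒜ₘ of 𝒱^k with compositions Q₁, …, Qₘ ∈ 𝒫ₙ(𝒳), and for every choice of parameters λ_ic > 0 and ρ_ic ≥ 1 (one pair for each class c and each type Pᵢ ∈ Λ_c), there exists a joint source-channel code of parameters (k, n) whose error probability satisfies p_e ≤ e^{nε} · Σ_{c=1}^{m} Σ_{Pᵢ ∈ Λ_c} exp(−n[ E′_x(Q_c, ρ_ic) + (λ_ic − ρ_ic)·t·H(Pᵢ) − t·E_s(λ_ic, P_V) ]). -/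
open scoped Classical BigOperators

noncomputable section

set_option linter.unusedSectionVars false

lemma fact_ineq (a b : ℕ) : b.factorial * b ^ a ≤ a.factorial * b ^ b := by
  rcases le_total b a with h | h
  · have h1 := Nat.factorial_mul_pow_sub_le_factorial h
    calc b.factorial * b ^ a = b.factorial * b ^ (a - b) * b ^ b := by
          rw [mul_assoc, ← pow_add, Nat.sub_add_cancel h]
      _ ≤ _ := Nat.mul_le_mul_right _ h1
  · have h1 := Nat.factorial_mul_descFactorial (n := b) (k := b - a) (Nat.sub_le _ _)
    have h2 := Nat.descFactorial_le_pow b (b - a)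
    rw [Nat.sub_sub_self h] at h1
    calc b.factorial * b ^ a = a.factorial * (b.descFactorial (b - a) * b ^ a) := by
          rw [← h1]; ring
      _ ≤ a.factorial * (b ^ (b - a) * b ^ a) := by gcongr
      _ = _ := by rw [← pow_add, Nat.sub_add_cancel h]

lemma multin_ineq {X : Type} [Fintype X] (c : X → ℕ) (n : ℕ) (hc : ∑ a, c a = n) :
    n ^ n * ∏ a, (c a).factorial ≤
      (n + 1) ^ Fintype.card X * n.factorial * ∏ a, c a ^ c a := by
  have hcard : (Finset.piAntidiag (Finset.univ : Finset X) n).card ≤ (n + 1) ^ Fintype.card X := by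
    calc _ ≤ (Fintype.piFinset (fun _ : X => Finset.range (n + 1))).card := by
          apply Finset.card_le_card
          intro f hf
          rw [Finset.mem_piAntidiag] at hf
          rw [Fintype.mem_piFinset]
          intro a
          rw [Finset.mem_range, Nat.lt_succ_iff, ← hf.1]
          exact Finset.single_le_sum (fun _ _ => Nat.zero_le _) (Finset.mem_univ a)
      _ = _ := by simp [Fintype.card_piFinset]
  have h1 : n ^ n = ∑ k ∈ Finset.piAntidiag (Finset.univ : Finset X) n,
      Nat.multinomial Finset.univ k * ∏ i, c i ^ k i := by
    have := Finset.sum_pow_eq_sum_piAntidiag (Finset.univ : Finset X) c n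
    rw [hc] at this
    simpa using this
  rw [h1, Finset.sum_mul]
  calc _ ≤ ∑ k ∈ Finset.piAntidiag (Finset.univ : Finset X) n,
        n.factorial * ∏ a, c a ^ c a := by
        apply Finset.sum_le_sum
        intro k hk
        rw [Finset.mem_piAntidiag] at hk
        calc Nat.multinomial Finset.univ k * (∏ i, c i ^ k i) * ∏ a, (c a).factorial
            = Nat.multinomial Finset.univ k * ∏ a, ((c a).factorial * c a ^ k a) := by
              rw [Finset.prod_mul_distrib]; ring
          _ ≤ Nat.multinomial Finset.univ k * ∏ a, ((k a).factorial * c a ^ c a) := by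
              apply Nat.mul_le_mul_left
              exact Finset.prod_le_prod' fun a _ => fact_ineq _ _
          _ = ((∏ a, (k a).factorial) * Nat.multinomial Finset.univ k) * ∏ a, c a ^ c a := by
              rw [Finset.prod_mul_distrib]; ring
          _ = _ := by rw [Nat.multinomial_spec, hk.1]
    _ ≤ _ := by
        rw [Finset.sum_const, smul_eq_mul, mul_assoc]
        gcongr

lemma perm_count {X : Type} [Fintype X] {n : ℕ} (q z : Fin n → X) :
    (Finset.univ.filter fun σ : Equiv.Perm (Fin n) => q ∘ σ = z).card ≤
      ∏ a, ((Finset.univ.filter fun i => q i = a).card).factorial := by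
  have h := DomMulAct.stabilizer_card q
  simp only [Fintype.card_subtype] at h
  rw [← h]
  by_cases hz : ∃ σ0 : Equiv.Perm (Fin n), q ∘ σ0 = z
  · obtain ⟨σ0, h0⟩ := hz
    apply Finset.card_le_card_of_injOn (fun σ => σ * σ0⁻¹)
    · intro σ hσ
      simp only [Finset.coe_filter, Finset.mem_univ, true_and, Set.mem_ofPred_eq] at hσ ⊢
      funext i
      have h1 := congrFun (hσ.trans h0.symm) (σ0⁻¹ i)
      simpa using h1
    · intro σ _ τ _ h
      exact mul_right_cancel h
  · rw [Finset.filter_false_of_mem]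
    · simp
    · intro σ _ h; exact hz ⟨σ, h⟩

lemma perm_avg {X : Type} [Fintype X] {n : ℕ} (q : Fin n → X) (g : Fin n → X → ℝ)
    (hg : ∀ l a, 0 ≤ g l a) :
    ∑ σ : Equiv.Perm (Fin n), ∏ l, g l (q (σ l)) ≤
      ((n : ℝ) + 1) ^ Fintype.card X * (n.factorial : ℝ) *
        ∏ l, ∑ a, empDist q a * g l a := by
  set c : X → ℕ := fun a => (Finset.univ.filter fun i => q i = a).card with hcdef
  have hc : ∑ a, c a = n := by
    have := Finset.card_eq_sum_card_fiberwise (f := q) (s := Finset.univ) (t := Finset.univ)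
      (by simp)
    simpa using this.symm
  have he : ∀ a, empDist q a = (c a : ℝ) / n := fun a => rfl
  have he0 : ∀ a, 0 ≤ empDist q a := fun a => by rw [he]; positivity
  set π : ℝ := ∏ l, empDist q (q l) with hπ
  have hπpos : 0 < π := by
    apply Finset.prod_pos
    intro l _
    rw [he]
    have : 0 < c (q l) := Finset.card_pos.mpr ⟨l, by simp⟩
    have hn : 0 < n := l.pos
    positivity
  have hπ2 : π * (n : ℝ) ^ n = ∏ a, (c a : ℝ) ^ c a := by
    have h1 : π = ∏ a, (empDist q a) ^ c a := by
      rw [hπ, ← Finset.prod_fiberwise (s := Finset.univ) (g := q)]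
      apply Finset.prod_congr rfl
      intro a _
      rw [Finset.prod_congr rfl (g := fun _ => empDist q a), Finset.prod_const]
      intro i hi
      rw [(Finset.mem_filter.mp hi).2]
    have h2 : (n : ℝ) ^ n = ∏ a, (n : ℝ) ^ c a := by
      rw [Finset.prod_pow_eq_pow_sum, hc]
    rw [h1, h2, ← Finset.prod_mul_distrib]
    apply Finset.prod_congr rfl
    intro a _
    rw [he, ← mul_pow]
    rcases Nat.eq_zero_or_pos n with h | h
    · have : c a = 0 := by
        have := Finset.single_le_sum (f := c) (fun _ _ => Nat.zero_le _) (Finset.mem_univ a)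
        omega
      simp [this]
    · rw [div_mul_cancel₀]
      positivity
  have hmul : (n : ℝ) ^ n * ∏ a, ((c a).factorial : ℝ) ≤
      ((n : ℝ) + 1) ^ Fintype.card X * (n.factorial : ℝ) * ∏ a, (c a : ℝ) ^ c a := by
    exact_mod_cast multin_ineq c n hc
  have hpi_perm : ∀ σ : Equiv.Perm (Fin n), ∏ l, empDist q (q (σ l)) = π := fun σ =>
    Equiv.prod_comp σ (fun l => empDist q (q l))
  have key : (∑ σ : Equiv.Perm (Fin n), ∏ l, g l (q (σ l))) * π ≤
      (∏ a, ((c a).factorial : ℝ)) * ∏ l, ∑ a, empDist q a * g l a := by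
    calc (∑ σ : Equiv.Perm (Fin n), ∏ l, g l (q (σ l))) * π
        = ∑ σ : Equiv.Perm (Fin n), ∏ l, (empDist q ((q ∘ σ) l) * g l ((q ∘ σ) l)) := by
          rw [Finset.sum_mul]
          apply Finset.sum_congr rfl
          intro σ _
          rw [Finset.prod_mul_distrib, ← hpi_perm σ, mul_comm]; rfl
      _ = ∑ z : Fin n → X, ∑ σ ∈ Finset.univ.filter (fun σ : Equiv.Perm (Fin n) => q ∘ σ = z),
            ∏ l, (empDist q ((q ∘ σ) l) * g l ((q ∘ σ) l)) := by
          rw [Finset.sum_fiberwise (s := Finset.univ) (g := fun σ : Equiv.Perm (Fin n) => q ∘ σ)]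
      _ = ∑ z : Fin n → X, ((Finset.univ.filter fun σ : Equiv.Perm (Fin n) => q ∘ σ = z).card : ℝ)
            * ∏ l, (empDist q (z l) * g l (z l)) := by
          apply Finset.sum_congr rfl
          intro z _
          rw [← nsmul_eq_mul, ← Finset.sum_const]
          apply Finset.sum_congr rfl
          intro σ hσ
          rw [(Finset.mem_filter.mp hσ).2]
      _ ≤ ∑ z : Fin n → X, (∏ a, ((c a).factorial : ℝ)) * ∏ l, (empDist q (z l) * g l (z l)) := by
          apply Finset.sum_le_sum
          intro z _
          apply mul_le_mul_of_nonneg_right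
          · exact_mod_cast perm_count q z
          · exact Finset.prod_nonneg fun l _ => mul_nonneg (he0 _) (hg _ _)
      _ = _ := by
          rw [← Finset.mul_sum, Finset.prod_univ_sum]
          simp
  have hR : 0 ≤ ∏ l, ∑ a, empDist q a * g l a :=
    Finset.prod_nonneg fun l _ => Finset.sum_nonneg fun a _ => mul_nonneg (he0 _) (hg _ _)
  have hn0 : 0 < (n : ℝ) ^ n := by
    rcases Nat.eq_zero_or_pos n with h | h
    · subst h; simp
    · positivity
  refine le_of_mul_le_mul_right ?_ (mul_pos hπpos hn0)
  calc (∑ σ : Equiv.Perm (Fin n), ∏ l, g l (q (σ l))) * (π * (n : ℝ) ^ n)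
      = ((∑ σ : Equiv.Perm (Fin n), ∏ l, g l (q (σ l))) * π) * (n : ℝ) ^ n := by ring
    _ ≤ ((∏ a, ((c a).factorial : ℝ)) * ∏ l, ∑ a, empDist q a * g l a) * (n : ℝ) ^ n := by gcongr
    _ = ((n : ℝ) ^ n * ∏ a, ((c a).factorial : ℝ)) * ∏ l, ∑ a, empDist q a * g l a := by ring
    _ ≤ (((n : ℝ) + 1) ^ Fintype.card X * (n.factorial : ℝ) * ∏ a, (c a : ℝ) ^ c a) *
          ∏ l, ∑ a, empDist q a * g l a := by gcongr
    _ = _ := by rw [← hπ2]; ring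

lemma exists_good {I S : Type} [Fintype I] [DecidableEq I] [Fintype S] [Nonempty S]
    (H : I → I → S → S → ℝ) (hs : ∀ i j a b, H i j a b = H j i b a)
    (u : I → I → ℝ)
    (havg : ∀ i j a, ∑ b, H i j a b ≤ (Fintype.card S : ℝ) * u i j) :
    ∃ s : I → S, ∀ j, ∑ i ∈ Finset.univ.erase j, H i j (s i) (s j) ≤
      ∑ i ∈ Finset.univ.erase j, u i j := by
  set Φ : (I → S) → ℝ := fun s => ∑ i, ∑ k ∈ Finset.univ.erase i, H i k (s i) (s k) with hΦ
  obtain ⟨s, hmin⟩ := Finite.exists_min Φ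
  refine ⟨s, fun j => ?_⟩
  have dec : ∀ s' : I → S, Φ s' = 2 * ∑ i ∈ Finset.univ.erase j, H i j (s' i) (s' j) +
      ∑ i ∈ Finset.univ.erase j, ∑ k ∈ (Finset.univ.erase i).erase j, H i k (s' i) (s' k) := by
    intro s'
    simp only [hΦ]
    rw [← Finset.add_sum_erase _ _ (Finset.mem_univ j)]
    have : ∀ i ∈ Finset.univ.erase j, ∑ k ∈ Finset.univ.erase i, H i k (s' i) (s' k) =
        H i j (s' i) (s' j) + ∑ k ∈ (Finset.univ.erase i).erase j, H i k (s' i) (s' k) := by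
      intro i hi
      refine (Finset.add_sum_erase _ (fun k => H i k (s' i) (s' k)) ?_).symm
      simp only [Finset.mem_erase, Finset.mem_univ, and_true] at hi ⊢
      exact fun h => hi h.symm
    rw [Finset.sum_congr rfl this, Finset.sum_add_distrib]
    rw [Finset.sum_congr rfl (fun k _ => hs j k (s' j) (s' k))]
    ring
  have step : ∀ b : S, ∑ i ∈ Finset.univ.erase j, H i j (s i) (s j) ≤
      ∑ i ∈ Finset.univ.erase j, H i j (s i) b := by
    intro b
    have h := hmin (Function.update s j b)
    rw [dec s, dec (Function.update s j b)] at h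
    have e1 : ∑ i ∈ Finset.univ.erase j,
        H i j (Function.update s j b i) (Function.update s j b j) =
        ∑ i ∈ Finset.univ.erase j, H i j (s i) b := by
      apply Finset.sum_congr rfl
      intro i hi
      rw [Function.update_self, Function.update_of_ne (Finset.ne_of_mem_erase hi)]
    have e2 : ∑ i ∈ Finset.univ.erase j, ∑ k ∈ (Finset.univ.erase i).erase j,
        H i k (Function.update s j b i) (Function.update s j b k) =
        ∑ i ∈ Finset.univ.erase j, ∑ k ∈ (Finset.univ.erase i).erase j, H i k (s i) (s k) := by
      apply Finset.sum_congr rfl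
      intro i hi
      apply Finset.sum_congr rfl
      intro k hk
      rw [Function.update_of_ne (Finset.ne_of_mem_erase hi),
        Function.update_of_ne (Finset.ne_of_mem_erase hk)]
    rw [e1, e2] at h
    linarith
  have hcard : (0 : ℝ) < Fintype.card S := by exact_mod_cast Fintype.card_pos
  refine le_of_mul_le_mul_left ?_ hcard
  calc (Fintype.card S : ℝ) * ∑ i ∈ Finset.univ.erase j, H i j (s i) (s j)
      = ∑ b : S, ∑ i ∈ Finset.univ.erase j, H i j (s i) (s j) := by
        rw [Finset.sum_const, nsmul_eq_mul]; rfl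
    _ ≤ ∑ b : S, ∑ i ∈ Finset.univ.erase j, H i j (s i) b :=
        Finset.sum_le_sum fun b _ => step b
    _ = ∑ i ∈ Finset.univ.erase j, ∑ b : S, H i j (s i) b := Finset.sum_comm
    _ ≤ ∑ i ∈ Finset.univ.erase j, (Fintype.card S : ℝ) * u i j :=
        Finset.sum_le_sum fun i _ => havg i j (s i)
    _ = _ := by rw [Finset.mul_sum]

lemma combine {I T : Type} [Fintype I] [DecidableEq I] [DecidableEq T] (ty : I → T) (𝒯 : Finset T) (hty : ∀ v, ty v ∈ 𝒯)
    (p G : T → ℝ) (hp : ∀ i, 0 ≤ p i) (hG : ∀ i, 0 ≤ G i)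
    (B : I → I → ℝ) (hBs : ∀ v w, B v w = B w v)
    (hB : ∀ w i, ∑ v ∈ (Finset.univ.filter fun v => ty v = i).erase w, B v w ≤ G i) :
    ∑ v, ∑ w ∈ Finset.univ.erase v, √(p (ty v) * p (ty w)) * B v w ≤
      (𝒯.card : ℝ) * ∑ i ∈ 𝒯,
        p i * ((Finset.univ.filter fun v => ty v = i).card : ℝ) * G i := by
  set M : T → ℝ := fun i => ((Finset.univ.filter fun v => ty v = i).card : ℝ) with hM
  have hM0 : ∀ i, 0 ≤ M i := fun i => Nat.cast_nonneg _
  set A : T → T → ℝ := fun i j => ∑ v ∈ Finset.univ.filter fun v => ty v = i,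
    ∑ w ∈ (Finset.univ.filter fun w => ty w = j).erase v, B v w with hA
  have hA1 : ∀ i j, A i j ≤ M i * G j := by
    intro i j
    simp only [hA, hM]
    rw [← nsmul_eq_mul, ← Finset.sum_const]
    apply Finset.sum_le_sum
    intro v _
    rw [Finset.sum_congr rfl (fun w _ => hBs v w)]
    exact hB v j
  have hAs : ∀ i j, A i j = A j i := by
    intro i j
    simp only [hA]
    have : ∀ i j, ∑ v ∈ Finset.univ.filter (fun v => ty v = i),
        ∑ w ∈ (Finset.univ.filter fun w => ty w = j).erase v, B v w =
        ∑ v : I, ∑ w : I, if ty v = i ∧ ty w = j ∧ w ≠ v then B v w else 0 := by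
      intro i j
      rw [Finset.sum_filter]
      apply Finset.sum_congr rfl
      intro v _
      by_cases h : ty v = i
      · rw [if_pos h, ← Finset.sum_filter]
        apply Finset.sum_congr _ (fun _ _ => rfl)
        ext w
        simp [h, and_comm]
      · simp [h]
    rw [this, this, Finset.sum_comm]
    apply Finset.sum_congr rfl
    intro v _
    apply Finset.sum_congr rfl
    intro w _
    rw [hBs w v]
    congr 1
    apply propext
    constructor
    · rintro ⟨a, b, c⟩; exact ⟨b, a, c.symm⟩
    · rintro ⟨a, b, c⟩; exact ⟨b, a, c.symm⟩
  have hA2 : ∀ i j, √(p i * p j) * A i j ≤ (p i * M i * G i + p j * M j * G j) / 2 := by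
    intro i j
    have h1 := hA1 i j
    have h2 := hA1 j i
    rw [← hAs i j] at h2
    have ha : 0 ≤ p i * M i * G i := mul_nonneg (mul_nonneg (hp _) (hM0 _)) (hG _)
    have hb : 0 ≤ p j * M j * G j := mul_nonneg (mul_nonneg (hp _) (hM0 _)) (hG _)
    by_cases hneg : A i j ≤ 0
    · have : √(p i * p j) * A i j ≤ 0 := mul_nonpos_of_nonneg_of_nonpos (Real.sqrt_nonneg _) hneg
      linarith
    · push Not at hneg
      apply le_of_sq_le_sq _ (by linarith)
      have h3 : A i j ^ 2 ≤ (M i * G j) * (M j * G i) := by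
        rw [sq]; exact mul_le_mul h1 h2 hneg.le (hneg.le.trans h1)
      rw [mul_pow, Real.sq_sqrt (mul_nonneg (hp _) (hp _))]
      calc p i * p j * A i j ^ 2 ≤ p i * p j * ((M i * G j) * (M j * G i)) :=
            mul_le_mul_of_nonneg_left h3 (mul_nonneg (hp _) (hp _))
        _ = (p i * M i * G i) * (p j * M j * G j) := by ring
        _ ≤ _ := by nlinarith [sq_nonneg (p i * M i * G i - p j * M j * G j)]
  have hdec : ∑ v, ∑ w ∈ Finset.univ.erase v, √(p (ty v) * p (ty w)) * B v w =
      ∑ i ∈ 𝒯, ∑ j ∈ 𝒯, √(p i * p j) * A i j := by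
    rw [← Finset.sum_fiberwise_of_maps_to (s := Finset.univ) (t := 𝒯) (g := ty)
      (fun v _ => hty v)]
    apply Finset.sum_congr rfl
    intro i _
    simp only [hA, Finset.mul_sum]
    rw [Finset.sum_comm]
    apply Finset.sum_congr rfl
    intro v hv
    rw [← Finset.sum_fiberwise_of_maps_to (s := Finset.univ.erase v) (t := 𝒯) (g := ty)
      (fun v _ => hty v)]
    apply Finset.sum_congr rfl
    intro j _
    rw [Finset.filter_erase]
    apply Finset.sum_congr rfl
    intro w hw
    rw [(Finset.mem_filter.mp hv).2, (Finset.mem_filter.mp (Finset.mem_of_mem_erase hw)).2]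
  rw [hdec]
  calc _ ≤ ∑ i ∈ 𝒯, ∑ j ∈ 𝒯, (p i * M i * G i + p j * M j * G j) / 2 :=
        Finset.sum_le_sum fun i _ => Finset.sum_le_sum fun j _ => hA2 i j
    _ = _ := by
        simp only [add_div, Finset.sum_add_distrib, Finset.sum_const, nsmul_eq_mul,
          ← Finset.mul_sum, ← Finset.sum_div]
        ring

section chan
variable {X Y : Type} [Fintype X] [Fintype Y]

lemma empDist_nonneg {α : Type} [Fintype α] {k : ℕ} (v : Fin k → α) (a : α) :
    0 ≤ empDist v a := by unfold empDist; positivity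

lemma sum_comp_eq {α : Type} [Fintype α] {k : ℕ} (v : Fin k → α) (g : α → ℝ) :
    ∑ l, g (v l) = (k : ℝ) * ∑ a, empDist v a * g a := by
  rcases Nat.eq_zero_or_pos k with h | h
  · subst h; simp
  · rw [← Finset.sum_fiberwise (s := Finset.univ) (g := v), Finset.mul_sum]
    apply Finset.sum_congr rfl
    intro a _
    rw [Finset.sum_congr rfl (g := fun _ => g a), Finset.sum_const, nsmul_eq_mul]
    · unfold empDist
      have : (k : ℝ) ≠ 0 := by positivity
      field_simp
    · intro i hi
      rw [(Finset.mem_filter.mp hi).2]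

lemma empDist_prob {α : Type} [Fintype α] {k : ℕ} (hk : 0 < k) (v : Fin k → α) :
    IsProbDist (empDist v) := by
  refine ⟨empDist_nonneg v, ?_⟩
  have h := sum_comp_eq v (fun _ => 1)
  have : (k : ℝ) ≠ 0 := by positivity
  simp only [Finset.sum_const, Finset.card_univ, Fintype.card_fin, nsmul_eq_mul, mul_one] at h
  exact (mul_left_cancel₀ this (by rw [mul_one]; exact h)).symm

lemma bh_le (W : X → Y → ℝ) (hW : IsDMC W) (x x' : X) :
    ∑ y, √(W x y * W x' y) ≤ 1 := by
  calc ∑ y, √(W x y * W x' y) ≤ ∑ y, (W x y + W x' y) / 2 := by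
        apply Finset.sum_le_sum
        intro y _
        have h1 := hW.1 x y
        have h2 := hW.1 x' y
        rw [Real.sqrt_le_left (by linarith)]
        nlinarith [sq_nonneg (W x y - W x' y)]
    _ = 1 := by
        rw [← Finset.sum_div, Finset.sum_add_distrib, hW.2, hW.2]; norm_num

lemma dB_nonneg (W : X → Y → ℝ) (hW : IsDMC W) (x x' : X) : 0 ≤ dB W x x' := by
  unfold dB
  have := Real.log_nonpos (Finset.sum_nonneg fun y _ => Real.sqrt_nonneg _) (bh_le W hW x x')
  linarith

lemma bh_le_exp (W : X → Y → ℝ) (x x' : X) :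
    ∑ y, √(W x y * W x' y) ≤ Real.exp (-dB W x x') := by
  unfold dB
  rw [neg_neg]
  exact Real.le_exp_log _

lemma dB_symm (W : X → Y → ℝ) (x x' : X) : dB W x x' = dB W x' x := by
  unfold dB
  simp only [mul_comm (W x _)]

/-- Pairwise Bhattacharyya product. -/
def Bn (W : X → Y → ℝ) {n : ℕ} (x x' : Fin n → X) : ℝ := Real.exp (-∑ l, dB W (x l) (x' l))

lemma Bn_symm (W : X → Y → ℝ) {n : ℕ} (x x' : Fin n → X) : Bn W x x' = Bn W x' x := by
  unfold Bn
  simp only [dB_symm W (x _)]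

lemma Bn_pow (W : X → Y → ℝ) {n : ℕ} (x x' : Fin n → X) (ρ : ℝ) :
    Bn W x x' ^ (1 / ρ) = ∏ l, Real.exp (-dB W (x l) (x' l) / ρ) := by
  unfold Bn
  rw [← Real.exp_mul, ← Real.exp_sum, ← Finset.sum_div, Finset.sum_neg_distrib]
  congr 1; ring

lemma Wn_bh (W : X → Y → ℝ) (hW : IsDMC W) {n : ℕ} (x x' : Fin n → X) :
    ∑ y : Fin n → Y, √(Wn W x y * Wn W x' y) ≤ Bn W x x' := by
  unfold Wn Bn
  calc ∑ y : Fin n → Y, √((∏ l, W (x l) (y l)) * ∏ l, W (x' l) (y l))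
      = ∑ y : Fin n → Y, ∏ l, √(W (x l) (y l) * W (x' l) (y l)) := by
        apply Finset.sum_congr rfl
        intro y _
        rw [← Finset.prod_mul_distrib, Real.sqrt_prod]
        exact fun l _ => mul_nonneg (hW.1 _ _) (hW.1 _ _)
    _ = ∏ l, ∑ y, √(W (x l) y * W (x' l) y) := by
        rw [Finset.prod_univ_sum]; simp
    _ ≤ ∏ l, Real.exp (-dB W (x l) (x' l)) := by
        apply Finset.prod_le_prod
        · exact fun l _ => Finset.sum_nonneg fun y _ => Real.sqrt_nonneg _
        · exact fun l _ => bh_le_exp W _ _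
    _ = _ := by rw [← Real.exp_sum, Finset.sum_neg_distrib]

/-- The function minimised in `Ex'`. -/
def Fx (W : X → Y → ℝ) (Q : X → ℝ) (ρ : ℝ) (Q' : X → ℝ) : ℝ :=
  -ρ * ∑ x, Q x * Real.log (∑ x', Q' x' * Real.exp (-dB W x x' / ρ))

lemma Z_pos (W : X → Y → ℝ) (Q' : X → ℝ) (h : IsProbDist Q') (ρ : ℝ) (x : X) :
    0 < ∑ x', Q' x' * Real.exp (-dB W x x' / ρ) := by
  have hne : ∃ a, 0 < Q' a := by
    by_contra hcon
    push Not at hcon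
    have : ∑ a, Q' a ≤ 0 := Finset.sum_nonpos fun a _ => hcon a
    rw [h.2] at this
    linarith
  obtain ⟨a, ha⟩ := hne
  exact Finset.sum_pos' (fun a _ => mul_nonneg (h.1 a) (Real.exp_pos _).le)
    ⟨a, Finset.mem_univ a, mul_pos ha (Real.exp_pos _)⟩

lemma Fx_nonneg (W : X → Y → ℝ) (hW : IsDMC W) (Q : X → ℝ) (hQ : IsProbDist Q) (ρ : ℝ)
    (hρ : 0 < ρ) (Q' : X → ℝ) (h : IsProbDist Q') : 0 ≤ Fx W Q ρ Q' := by
  unfold Fx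
  have : ∑ x, Q x * Real.log (∑ x', Q' x' * Real.exp (-dB W x x' / ρ)) ≤ 0 := by
    apply Finset.sum_nonpos
    intro x _
    apply mul_nonpos_of_nonneg_of_nonpos (hQ.1 x)
    apply Real.log_nonpos (Z_pos W Q' h ρ x).le
    rw [← h.2]
    apply Finset.sum_le_sum
    intro a _
    apply mul_le_of_le_one_right (h.1 a)
    rw [Real.exp_le_one_iff]
    have := dB_nonneg W hW x a
    apply div_nonpos_of_nonpos_of_nonneg <;> linarith
  nlinarith

lemma Ex'_le (W : X → Y → ℝ) (hW : IsDMC W) (Q : X → ℝ) (hQ : IsProbDist Q) (ρ : ℝ)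
    (hρ : 0 < ρ) (Q' : X → ℝ) (h : IsProbDist Q') : Ex' W Q ρ ≤ Fx W Q ρ Q' := by
  apply csInf_le
  · refine ⟨0, ?_⟩
    rintro z ⟨Q1, h1, rfl⟩
    exact Fx_nonneg W hW Q hQ ρ hρ Q1 h1
  · exact ⟨Q', h, rfl⟩

lemma Fx_upper (W : X → Y → ℝ) (Q : X → ℝ) (hQ : IsProbDist Q) (ρ : ℝ)
    (hρ : 0 < ρ) (Q' : X → ℝ) (h : IsProbDist Q') :
    Fx W Q ρ Q' ≤ ∑ x, Q x * ∑ x', Q' x' * dB W x x' := by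
  unfold Fx
  rw [Finset.mul_sum]
  apply Finset.sum_le_sum
  intro x _
  have hj : -(∑ x', Q' x' * dB W x x') / ρ ≤
      Real.log (∑ x', Q' x' * Real.exp (-dB W x x' / ρ)) := by
    rw [Real.le_log_iff_exp_le (Z_pos W Q' h ρ x)]
    have := convexOn_exp.map_sum_le (t := Finset.univ) (w := Q')
      (p := fun x' => -dB W x x' / ρ) (fun a _ => h.1 a) h.2 (fun _ _ => Set.mem_univ _)
    simp only [smul_eq_mul] at this
    refine le_trans (le_of_eq ?_) this
    congr 1
    rw [← Finset.sum_neg_distrib, Finset.sum_div]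
    apply Finset.sum_congr rfl
    intro a _; ring
  have h2 : -(∑ x', Q' x' * dB W x x') ≤
      ρ * Real.log (∑ x', Q' x' * Real.exp (-dB W x x' / ρ)) := by
    rw [div_le_iff₀ hρ] at hj; linarith
  have := mul_le_mul_of_nonneg_left h2 (hQ.1 x)
  linarith

lemma exp_neg_quad (u : ℝ) (hu : 0 ≤ u) : Real.exp (-u) ≤ 1 - u + u ^ 2 := by
  have h1 : 1 + u ≤ Real.exp u := by linarith [Real.add_one_le_exp u]
  rw [Real.exp_neg]
  rw [inv_le_iff_one_le_mul₀ (Real.exp_pos u)]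
  have : 0 ≤ 1 - u + u ^ 2 := by nlinarith [sq_nonneg (u - 1)]
  nlinarith [mul_le_mul_of_nonneg_left h1 this, pow_nonneg hu 3]

lemma Fx_lower (W : X → Y → ℝ) (hW : IsDMC W) (Q : X → ℝ) (hQ : IsProbDist Q) (ρ : ℝ)
    (hρ : 0 < ρ) (Q' : X → ℝ) (h : IsProbDist Q') (D : ℝ) (hD : ∀ x x', dB W x x' ≤ D) :
    ∑ x, Q x * ∑ x', Q' x' * dB W x x' ≤ Fx W Q ρ Q' + D ^ 2 / ρ := by
  have key : ∀ x, ρ * Real.log (∑ x', Q' x' * Real.exp (-dB W x x' / ρ)) ≤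
      -(∑ x', Q' x' * dB W x x') + D ^ 2 / ρ := by
    intro x
    have h1 := Real.log_le_sub_one_of_pos (Z_pos W Q' h ρ x)
    have h2 : ∑ x', Q' x' * Real.exp (-dB W x x' / ρ) ≤
        ∑ x', (Q' x' - Q' x' * dB W x x' / ρ + Q' x' * (D ^ 2 / ρ ^ 2)) := by
      apply Finset.sum_le_sum
      intro a _
      have hd := dB_nonneg W hW x a
      have h3 := exp_neg_quad (dB W x a / ρ) (div_nonneg hd hρ.le)
      have h4 : (dB W x a / ρ) ^ 2 ≤ D ^ 2 / ρ ^ 2 := by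
        rw [div_pow]
        have := hD x a
        gcongr
      rw [neg_div]
      calc Q' a * Real.exp (-(dB W x a / ρ)) ≤ Q' a * (1 - dB W x a / ρ + D ^ 2 / ρ ^ 2) :=
            mul_le_mul_of_nonneg_left (by linarith) (h.1 a)
        _ = _ := by ring
    rw [Finset.sum_add_distrib, Finset.sum_sub_distrib, ← Finset.sum_mul, ← Finset.sum_div, h.2]
      at h2
    have h5 : Real.log (∑ x', Q' x' * Real.exp (-dB W x x' / ρ)) ≤
      -(∑ x', Q' x' * dB W x x') / ρ + D ^ 2 / ρ ^ 2 := by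
      rw [neg_div]; linarith
    calc _ ≤ ρ * (-(∑ x', Q' x' * dB W x x') / ρ + D ^ 2 / ρ ^ 2) :=
          mul_le_mul_of_nonneg_left h5 hρ.le
      _ = _ := by field_simp
  unfold Fx
  have h6 : ∑ x, Q x * (ρ * Real.log (∑ x', Q' x' * Real.exp (-dB W x x' / ρ))) ≤
      ∑ x, Q x * (-(∑ x', Q' x' * dB W x x') + D ^ 2 / ρ) :=
    Finset.sum_le_sum fun x _ => mul_le_mul_of_nonneg_left (key x) (hQ.1 x)
  have e1 : ∑ x, Q x * (ρ * Real.log (∑ x', Q' x' * Real.exp (-dB W x x' / ρ))) =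
      ρ * ∑ x, Q x * Real.log (∑ x', Q' x' * Real.exp (-dB W x x' / ρ)) := by
    rw [Finset.mul_sum]
    exact Finset.sum_congr rfl fun x _ => by ring
  have e2 : ∑ x, Q x * (-(∑ x', Q' x' * dB W x x') + D ^ 2 / ρ) =
      -(∑ x, Q x * ∑ x', Q' x' * dB W x x') + D ^ 2 / ρ := by
    simp only [mul_add, Finset.sum_add_distrib, ← Finset.sum_mul, hQ.2, mul_neg,
      Finset.sum_neg_distrib, one_mul]
  rw [e1, e2] at h6
  linarith

lemma Ex'_compare (W : X → Y → ℝ) (hW : IsDMC W) (Q : X → ℝ) (hQ : IsProbDist Q) (ρ r : ℝ)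
    (hρ : 0 < ρ) (hr : 0 < r) (D : ℝ) (hD : ∀ x x', dB W x x' ≤ D) :
    Ex' W Q ρ ≤ Ex' W Q r + D ^ 2 / r := by
  have : Ex' W Q ρ - D ^ 2 / r ≤ Ex' W Q r := by
    apply le_csInf
    · exact ⟨_, Q, hQ, rfl⟩
    · rintro z ⟨Q1, h1, rfl⟩
      have a1 := Ex'_le W hW Q hQ ρ hρ Q1 h1
      have a2 := Fx_upper W Q hQ ρ hρ Q1 h1
      have a3 := Fx_lower W hW Q hQ r hr Q1 h1 D hD
      change _ ≤ Fx W Q r Q1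
      linarith
  linarith

lemma avg_bound (W : X → Y → ℝ) (hW : IsDMC W) {n : ℕ} (hn : 0 < n) (x q : Fin n → X) (r : ℝ)
    (hr : 0 < r) :
    ∑ σ : Equiv.Perm (Fin n), Bn W x (q ∘ σ) ^ (1 / r) ≤
      (n.factorial : ℝ) * (((n : ℝ) + 1) ^ Fintype.card X *
        Real.exp (-(n : ℝ) * Ex' W (empDist x) r / r)) := by
  have h1 := perm_avg q (fun l a => Real.exp (-dB W (x l) a / r)) (fun _ _ => (Real.exp_pos _).le)
  simp only [Bn_pow, Function.comp]
  refine h1.trans ?_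
  rw [mul_comm (_ ^ _) (n.factorial : ℝ), mul_assoc]
  gcongr
  have hq := empDist_prob hn q
  have hx := empDist_prob hn x
  have e : ∏ l, ∑ a, empDist q a * Real.exp (-dB W (x l) a / r) =
      Real.exp (∑ l, Real.log (∑ a, empDist q a * Real.exp (-dB W (x l) a / r))) := by
    rw [Real.exp_sum]
    exact Finset.prod_congr rfl fun l _ => (Real.exp_log (Z_pos W _ hq r _)).symm
  rw [e, sum_comp_eq x (fun b => Real.log (∑ a, empDist q a * Real.exp (-dB W b a / r)))]
  apply Real.exp_le_exp.mpr
  have h2 := Ex'_le W hW _ hx r hr _ hq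
  unfold Fx at h2
  rw [le_div_iff₀ hr]
  have : (0 : ℝ) ≤ n := by positivity
  nlinarith

lemma avg_bound' (W : X → Y → ℝ) (hW : IsDMC W) {n : ℕ} (hn : 0 < n) (x q : Fin n → X) (r : ℝ)
    (hr : 0 < r) :
    ∑ σ : Equiv.Perm (Fin n), Bn W x (q ∘ σ) ^ (1 / r) ≤
      (n.factorial : ℝ) * (((n : ℝ) + 1) ^ Fintype.card X *
        Real.exp (-(n : ℝ) * Ex' W (empDist q) r / r)) := by
  refine le_trans (le_of_eq ?_) (avg_bound W hW hn q x r hr)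
  rw [← Equiv.sum_comp (Equiv.inv (Equiv.Perm (Fin n)))]
  apply Finset.sum_congr rfl
  intro σ _
  congr 1
  rw [Bn_symm]
  unfold Bn
  congr 2
  rw [← Equiv.sum_comp σ]
  simp

end chan

section src
variable {V X Y : Type} [Fintype V] [Fintype X] [Fintype Y]

lemma prodDist_nonneg (PV : V → ℝ) (hPV : IsProbDist PV) {k : ℕ} (v : Fin k → V) :
    0 ≤ prodDist PV v := Finset.prod_nonneg fun _ _ => hPV.1 _

lemma exists_map (PV : V → ℝ) (hPV : IsProbDist PV) (W : X → Y → ℝ) (hW : IsDMC W) {k n : ℕ}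
    [Nonempty (Fin k → V)] (f : (Fin k → V) → Fin n → X) :
    ∃ φ : (Fin n → Y) → Fin k → V, pErr PV W f φ ≤
      ∑ v, ∑ w ∈ Finset.univ.erase v, √(prodDist PV v * prodDist PV w) * Bn W (f v) (f w) := by
  have hex : ∀ y : Fin n → Y, ∃ v, ∀ w,
      prodDist PV w * Wn W (f w) y ≤ prodDist PV v * Wn W (f v) y := fun y =>
    Finite.exists_max (fun v => prodDist PV v * Wn W (f v) y)
  choose φ hφ using hex
  refine ⟨φ, ?_⟩
  unfold pErr
  have hWn : ∀ v y, 0 ≤ Wn W (f v) y := fun v y => Finset.prod_nonneg fun _ _ => hW.1 _ _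
  have hp := fun v : Fin k → V => prodDist_nonneg PV hPV v
  apply Finset.sum_le_sum
  intro v _
  rw [Finset.mul_sum]
  calc ∑ y ∈ Finset.univ.filter (fun y : Fin n → Y => φ y ≠ v), prodDist PV v * Wn W (f v) y
      ≤ ∑ y ∈ Finset.univ.filter (fun y : Fin n → Y => φ y ≠ v),
          ∑ w ∈ Finset.univ.erase v,
            √(prodDist PV v * prodDist PV w) * √(Wn W (f v) y * Wn W (f w) y) := by
        apply Finset.sum_le_sum
        intro y hy
        have hne := (Finset.mem_filter.mp hy).2
        refine le_trans ?_ (Finset.single_le_sum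
          (f := fun w => √(prodDist PV v * prodDist PV w) * √(Wn W (f v) y * Wn W (f w) y))
          (fun w _ => mul_nonneg (Real.sqrt_nonneg _) (Real.sqrt_nonneg _))
          (Finset.mem_erase.mpr ⟨hne, Finset.mem_univ _⟩))
        rw [← Real.sqrt_mul (mul_nonneg (hp _) (hp _))]
        apply Real.le_sqrt_of_sq_le
        have h1 := hφ y v
        have h2 := mul_le_mul_of_nonneg_left h1 (mul_nonneg (hp v) (hWn v y))
        nlinarith
    _ ≤ ∑ y, ∑ w ∈ Finset.univ.erase v,
            √(prodDist PV v * prodDist PV w) * √(Wn W (f v) y * Wn W (f w) y) := by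
        apply Finset.sum_le_sum_of_subset_of_nonneg (Finset.filter_subset _ _)
        intro y _ _
        exact Finset.sum_nonneg fun w _ => mul_nonneg (Real.sqrt_nonneg _) (Real.sqrt_nonneg _)
    _ = ∑ w ∈ Finset.univ.erase v, √(prodDist PV v * prodDist PV w) *
          ∑ y, √(Wn W (f v) y * Wn W (f w) y) := by
        rw [Finset.sum_comm]
        simp only [Finset.mul_sum]
    _ ≤ _ := by
        apply Finset.sum_le_sum
        intro w _
        exact mul_le_mul_of_nonneg_left (Wn_bh W hW _ _) (Real.sqrt_nonneg _)

lemma empDist_pos {k : ℕ} (v : Fin k → V) (l : Fin k) : 0 < empDist v (v l) := by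
  unfold empDist
  have h1 : 0 < (Finset.univ.filter fun i => v i = v l).card := Finset.card_pos.mpr ⟨l, by simp⟩
  have h2 : 0 < k := l.pos
  positivity

lemma exists_of_empDist_pos {k : ℕ} (v : Fin k → V) (a : V) (h : 0 < empDist v a) :
    ∃ l, v l = a := by
  by_contra hcon
  push Not at hcon
  have : empDist v a = 0 := by
    unfold empDist
    rw [Finset.filter_false_of_mem (fun i _ => hcon i)]
    simp
  linarith

lemma prodDist_eq (P : V → ℝ) {k : ℕ} (v : Fin k → V) (hpos : ∀ l, 0 < P (v l)) :
    prodDist P v = Real.exp ((k : ℝ) * ∑ a, empDist v a * Real.log (P a)) := by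
  rw [← sum_comp_eq v (fun a => Real.log (P a)), Real.exp_sum]
  exact Finset.prod_congr rfl fun l _ => (Real.exp_log (hpos l)).symm

lemma type_card {k : ℕ} (hk : 0 < k) (v : Fin k → V) :
    ((Finset.univ.filter fun w : Fin k → V => empDist w = empDist v).card : ℝ) ≤
      Real.exp ((k : ℝ) * entH (empDist v)) := by
  have hQ := empDist_prob hk v
  have h1 : ∑ w : Fin k → V, prodDist (empDist v) w = 1 := by
    have : ∏ _l : Fin k, ∑ a, empDist v a = 1 := by simp [hQ.2]
    rw [Finset.prod_univ_sum] at this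
    simpa [prodDist] using this
  have h2 : ∀ w ∈ Finset.univ.filter (fun w : Fin k → V => empDist w = empDist v),
      prodDist (empDist v) w = Real.exp (-((k : ℝ) * entH (empDist v))) := by
    intro w hw
    have hw' := (Finset.mem_filter.mp hw).2
    rw [← hw', prodDist_eq (empDist w) w (fun l => empDist_pos w l)]
    unfold entH
    congr 1; ring
  have h3 : ∑ w ∈ Finset.univ.filter (fun w : Fin k → V => empDist w = empDist v),
      prodDist (empDist v) w ≤ 1 := by
    rw [← h1]
    apply Finset.sum_le_sum_of_subset_of_nonneg (Finset.filter_subset _ _)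
    intro w _ _
    exact prodDist_nonneg _ hQ w
  rw [Finset.sum_congr rfl h2, Finset.sum_const, nsmul_eq_mul, Real.exp_neg,
    ← div_eq_mul_inv, div_le_one (Real.exp_pos _)] at h3
  exact h3

lemma entH_nonneg (Q : V → ℝ) (hQ : IsProbDist Q) : 0 ≤ entH Q := by
  unfold entH
  have : ∑ a, Q a * Real.log (Q a) ≤ 0 := by
    apply Finset.sum_nonpos
    intro a _
    apply mul_nonpos_of_nonneg_of_nonpos (hQ.1 a)
    apply Real.log_nonpos (hQ.1 a)
    rw [← hQ.2]
    exact Finset.single_le_sum (fun b _ => hQ.1 b) (Finset.mem_univ a)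
  linarith

lemma Es_lower (PV : V → ℝ) (hPV : IsProbDist PV) (Q : V → ℝ) (hQ : IsProbDist Q)
    (hs : ∀ a, 0 < Q a → 0 < PV a) (lam : ℝ) (hl : 0 < lam) :
    ∑ a, Q a * Real.log (PV a) + (1 + lam) * entH Q ≤ Es PV lam := by
  set s : ℝ := 1 / (1 + lam) with hsdef
  have hspos : 0 < s := by positivity
  have hne : ∃ a, 0 < PV a := by
    by_contra hcon
    push Not at hcon
    have : ∑ a, PV a ≤ 0 := Finset.sum_nonpos fun a _ => hcon a
    rw [hPV.2] at this
    linarith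
  obtain ⟨a0, ha0⟩ := hne
  set S : ℝ := ∑ a, PV a ^ s with hS
  have hSpos : 0 < S := Finset.sum_pos' (fun a _ => Real.rpow_nonneg (hPV.1 a) _)
    ⟨a0, Finset.mem_univ _, Real.rpow_pos_of_pos ha0 _⟩
  have key : ∀ a, Q a * (s * Real.log (PV a) - Real.log (Q a) - Real.log S) ≤
      PV a ^ s / S - Q a := by
    intro a
    rcases (hQ.1 a).eq_or_lt with h | h
    · rw [← h]
      have := Real.rpow_nonneg (hPV.1 a) s
      have : 0 ≤ PV a ^ s / S := by positivity
      simpa using this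
    · have hP := hs a h
      have hPs := Real.rpow_pos_of_pos hP s
      have h1 := Real.log_le_sub_one_of_pos (x := PV a ^ s / (Q a * S)) (by positivity)
      rw [Real.log_div hPs.ne' (by positivity), Real.log_mul h.ne' hSpos.ne',
        Real.log_rpow hP] at h1
      have h2 := mul_le_mul_of_nonneg_left h1 h.le
      have h3 : Q a * (PV a ^ s / (Q a * S) - 1) = PV a ^ s / S - Q a := by
        field_simp
      linarith
  have hsum := Finset.sum_le_sum (s := Finset.univ) fun a _ => key a
  have e1 : ∑ a, (PV a ^ s / S - Q a) = 0 := by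
    rw [Finset.sum_sub_distrib, ← Finset.sum_div, hQ.2, ← hS, div_self hSpos.ne', sub_self]
  have e2 : ∑ a, Q a * (s * Real.log (PV a) - Real.log (Q a) - Real.log S) =
      s * ∑ a, Q a * Real.log (PV a) + entH Q - Real.log S := by
    have : ∀ a, Q a * (s * Real.log (PV a) - Real.log (Q a) - Real.log S) =
      s * (Q a * Real.log (PV a)) - Q a * Real.log (Q a) - Q a * Real.log S := fun a => by ring
    simp only [this, Finset.sum_sub_distrib, ← Finset.mul_sum, ← Finset.sum_mul, hQ.2]
    unfold entH; ring
  rw [e1, e2] at hsum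
  unfold Es
  rw [← hsdef, ← hS]
  have h4 : (1 + lam) * s = 1 := by rw [hsdef]; field_simp
  have h5 := mul_le_mul_of_nonneg_left hsum (show 0 ≤ 1 + lam by linarith)
  have h6 : (1 + lam) * (s * ∑ a, Q a * Real.log (PV a)) = ∑ a, Q a * Real.log (PV a) := by
    rw [← mul_assoc, h4, one_mul]
  nlinarith

lemma src_term (PV : V → ℝ) (hPV : IsProbDist PV) {k : ℕ} (hk : 0 < k) (v : Fin k → V)
    (T : ℝ) (hT1 : (k : ℝ) ≤ T) (hT2 : T ≤ k + 1) (lam rho r : ℝ) (hl : 0 < lam) (hr : 0 ≤ r)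
    (hrr : r ≤ rho) :
    prodDist PV v * ((Finset.univ.filter fun w : Fin k → V => empDist w = empDist v).card : ℝ) *
      ((Finset.univ.filter fun w : Fin k → V => empDist w = empDist v).card : ℝ) ^ r ≤
    Real.exp (∑ a, |Real.log (PV a)|) *
      Real.exp (T * (Es PV lam - (lam - rho) * entH (empDist v))) := by
  have hQ := empDist_prob hk v
  have hH := entH_nonneg _ hQ
  have hM := type_card hk v
  set M : ℝ := ((Finset.univ.filter fun w : Fin k → V => empDist w = empDist v).card : ℝ) with hMd
  have hM0 : 0 ≤ M := Nat.cast_nonneg _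
  set H := entH (empDist v) with hHd
  have hM1 : M ≤ Real.exp (T * H) := hM.trans (Real.exp_le_exp.mpr (by gcongr))
  have hM2 : M ^ r ≤ Real.exp (T * H * r) := by
    rw [Real.exp_mul]; exact Real.rpow_le_rpow hM0 hM1 hr
  by_cases hz : ∀ l, 0 < PV (v l)
  · have hs : ∀ a, 0 < empDist v a → 0 < PV a := by
      intro a ha
      obtain ⟨l, rfl⟩ := exists_of_empDist_pos v a ha
      exact hz l
    have hE := Es_lower PV hPV _ hQ hs lam hl
    rw [prodDist_eq PV v hz]
    set A := ∑ a, empDist v a * Real.log (PV a) with hA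
    set A0 := ∑ a, |Real.log (PV a)| with hA0
    have hA0' : 0 ≤ A0 := Finset.sum_nonneg fun a _ => abs_nonneg _
    have hAA : -A ≤ A0 := by
      rw [hA, hA0, ← Finset.sum_neg_distrib]
      apply Finset.sum_le_sum
      intro a _
      have h1 : empDist v a ≤ 1 := by
        rw [← hQ.2]
        exact Finset.single_le_sum (fun b _ => hQ.1 b) (Finset.mem_univ a)
      have h2 := hQ.1 a
      have h3 := neg_abs_le (Real.log (PV a))
      have h4 := abs_nonneg (Real.log (PV a))
      nlinarith
    have hkA : (k : ℝ) * A ≤ T * A + A0 := by nlinarith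
    have hTpos : 0 ≤ T := le_trans (Nat.cast_nonneg _) hT1
    calc Real.exp ((k : ℝ) * A) * M * M ^ r
        ≤ Real.exp (T * A + A0) * Real.exp (T * H) * Real.exp (T * H * r) := by gcongr
      _ = Real.exp (A0 + T * (A + H + H * r)) := by
          rw [← Real.exp_add, ← Real.exp_add]; congr 1; ring
      _ ≤ Real.exp (A0 + T * (Es PV lam - (lam - rho) * H)) := by
          apply Real.exp_le_exp.mpr
          have : H * r ≤ H * rho := by gcongr
          have : A + H + H * r ≤ Es PV lam - (lam - rho) * H := by
            rw [← hHd] at hE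
            linarith
          gcongr
      _ = _ := by rw [Real.exp_add]
  · push Not at hz
    obtain ⟨l, hl0⟩ := hz
    have : prodDist PV v = 0 :=
      Finset.prod_eq_zero (Finset.mem_univ l) (le_antisymm hl0 (hPV.1 _))
    rw [this]
    simp only [zero_mul]
    positivity

lemma types_card {k : ℕ} : (Finset.univ.image (empDist : (Fin k → V) → V → ℝ)).card ≤
    (k + 1) ^ Fintype.card V := by
  calc _ ≤ ((Fintype.piFinset (fun _ : V => Finset.range (k + 1))).image
        (fun c a => (c a : ℝ) / k)).card := by
        apply Finset.card_le_card
        intro P hP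
        obtain ⟨v, _, rfl⟩ := Finset.mem_image.mp hP
        refine Finset.mem_image.mpr
          ⟨fun a => (Finset.univ.filter fun i => v i = a).card, ?_, rfl⟩
        rw [Fintype.mem_piFinset]
        intro a
        rw [Finset.mem_range, Nat.lt_succ_iff]
        exact (Finset.card_le_univ _).trans (by simp)
    _ ≤ _ := Finset.card_image_le
    _ = _ := by simp [Fintype.card_piFinset]

lemma empDist_comp_perm {n : ℕ} (q : Fin n → X) (σ : Equiv.Perm (Fin n)) :
    empDist (q ∘ σ) = empDist q := by
  funext a
  unfold empDist
  congr 2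
  apply Finset.card_bij (fun i _ => σ i)
  · intro i hi; simpa using hi
  · intro i _ j _ h; exact σ.injective h
  · intro j hj; exact ⟨σ.symm j, by simpa using hj, by simp⟩

lemma sum_rpow_le {I : Type} (s : Finset I) (y : I → ℝ) (hy : ∀ i, 0 ≤ y i) (r : ℝ)
    (hr : 1 ≤ r) : ∑ i ∈ s, y i ^ r ≤ (∑ i ∈ s, y i) ^ r := by
  induction s using Finset.induction_on with
  | empty => simp [Real.zero_rpow (by linarith : r ≠ 0)]
  | insert a s ha ih =>
    rw [Finset.sum_insert ha, Finset.sum_insert ha]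
    refine le_trans (by gcongr) (Real.add_rpow_le_rpow_add (hy a)
      (Finset.sum_nonneg fun i _ => hy i) hr)

lemma poly_exp (t : ℝ) (ht : 0 < t) (ε : ℝ) (hε : 0 < ε) (a b R : ℕ) (A : ℝ) (hA : 0 < A) :
    ∃ n₀ : ℕ, ∀ n : ℕ, n₀ ≤ n → (t * n + 1) ^ a *
      (2 * (t * n + 1) ^ a * ((n : ℝ) + 1) ^ b) ^ R * A ≤ Real.exp (n * ε) := by
  set C : ℝ := (t + 1) ^ a * (2 * (t + 1) ^ a) ^ R * A with hC
  have hCpos : 0 < C := by positivity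
  have h := isLittleO_pow_exp_pos_mul_atTop (a + (a + b) * R) hε
  have h1 := h.def (c := 1 / (C * Real.exp ε)) (by positivity)
  have h2 : Filter.Tendsto (fun n : ℕ => (n : ℝ) + 1) Filter.atTop Filter.atTop :=
    Filter.tendsto_atTop_add_const_right _ _ tendsto_natCast_atTop_atTop
  obtain ⟨n₀, hn₀⟩ := Filter.eventually_atTop.mp (h2.eventually h1)
  refine ⟨n₀, fun n hn => ?_⟩
  have h3 := hn₀ n hn
  rw [Real.norm_of_nonneg (by positivity), Real.norm_of_nonneg (by positivity)] at h3
  have h4 : t * n + 1 ≤ (t + 1) * ((n : ℝ) + 1) := by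
    have : (0 : ℝ) ≤ n := by positivity
    nlinarith
  calc (t * n + 1) ^ a * (2 * (t * n + 1) ^ a * ((n : ℝ) + 1) ^ b) ^ R * A
      ≤ ((t + 1) * ((n : ℝ) + 1)) ^ a *
        (2 * ((t + 1) * ((n : ℝ) + 1)) ^ a * ((n : ℝ) + 1) ^ b) ^ R * A := by gcongr
    _ = C * ((n : ℝ) + 1) ^ (a + (a + b) * R) := by
        rw [hC, pow_add, pow_mul, pow_add]; simp only [mul_pow]; ring
    _ ≤ C * (1 / (C * Real.exp ε) * Real.exp (ε * ((n : ℝ) + 1))) := by gcongr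
    _ = Real.exp (n * ε) := by
        rw [show ε * ((n : ℝ) + 1) = n * ε + ε by ring, Real.exp_add]
        field_simp

end src

section main
variable {V X Y : Type} [Fintype V] [Fintype X] [Fintype Y]

lemma exists_code (W : X → Y → ℝ) (hW : IsDMC W) {k n : ℕ} (hn : 0 < n) {T : Type} [DecidableEq T]
    (ty : (Fin k → V) → T) (𝒯 : Finset T) (hty : ∀ v, ty v ∈ 𝒯)
    (q : (Fin k → V) → Fin n → X) (r : (Fin k → V) → ℝ) (hr : ∀ v, 1 ≤ r v)
    (hqt : ∀ v w, ty v = ty w → q v = q w) (hrt : ∀ v w, ty v = ty w → r v = r w) :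
    ∃ f : (Fin k → V) → Fin n → X, ∀ w v0,
      ∑ v ∈ (Finset.univ.filter fun v => ty v = ty v0).erase w, Bn W (f v) (f w) ≤
        (2 * (𝒯.card : ℝ) * (((n : ℝ) + 1) ^ Fintype.card X *
          Real.exp (-(n : ℝ) * Ex' W (empDist (q v0)) (r v0) / r v0)) *
          ((Finset.univ.filter fun v => ty v = ty v0).card : ℝ)) ^ (r v0) := by
  set β : (Fin k → V) → ℝ := fun v => ((n : ℝ) + 1) ^ Fintype.card X *
          Real.exp (-(n : ℝ) * Ex' W (empDist (q v)) (r v) / r v) with hβ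
  have hβpos : ∀ v, 0 < β v := fun v => by simp only [hβ]; positivity
  set M : (Fin k → V) → ℝ := fun v => ((Finset.univ.filter fun w => ty w = ty v).card : ℝ) with hM
  have hMpos : ∀ v, 0 < M v := fun v => by
    simp only [hM]
    exact_mod_cast Finset.card_pos.mpr ⟨v, by simp⟩
  have hBpos : ∀ (x x' : Fin n → X), 0 < Bn W x x' := fun x x' => Real.exp_pos _
  set H : (Fin k → V) → (Fin k → V) → Equiv.Perm (Fin n) → Equiv.Perm (Fin n) → ℝ :=
    fun v w σ τ => (Bn W (q v ∘ σ) (q w ∘ τ) ^ (1 / r v) / β v +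
      Bn W (q v ∘ σ) (q w ∘ τ) ^ (1 / r w) / β w) / (M v * M w) with hH
  obtain ⟨s, hs⟩ := exists_good H (by
      intro v w σ τ
      simp only [hH]
      rw [Bn_symm W (q v ∘ σ), mul_comm (M v), add_comm])
    (fun v w => 2 / (M v * M w)) (by
      intro v w σ
      simp only [hH]
      rw [← Finset.sum_div, Finset.sum_add_distrib, ← Finset.sum_div, ← Finset.sum_div]
      have h1 := avg_bound W hW hn (q v ∘ σ) (q w) (r v) (by linarith [hr v])
      have h2 := avg_bound' W hW hn (q v ∘ σ) (q w) (r w) (by linarith [hr w])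
      rw [empDist_comp_perm] at h1
      change _ ≤ _ * β v at h1
      change _ ≤ _ * β w at h2
      rw [← div_le_iff₀ (hβpos v)] at h1
      rw [← div_le_iff₀ (hβpos w)] at h2
      rw [Fintype.card_perm, Fintype.card_fin, ← mul_div_assoc]
      have := hMpos v
      have := hMpos w
      gcongr
      linarith)
  refine ⟨fun v => q v ∘ s v, fun w v0 => ?_⟩
  have hMsum : ∑ v, 1 / M v = (𝒯.filter fun i => ∃ v, ty v = i).card := by
    rw [← Finset.sum_fiberwise_of_maps_to (s := Finset.univ) (t := 𝒯) (g := ty)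
      (fun v _ => hty v), Finset.card_filter, Nat.cast_sum]
    apply Finset.sum_congr rfl
    intro i _
    by_cases h : ∃ v, ty v = i
    · obtain ⟨v, rfl⟩ := h
      rw [if_pos ⟨v, rfl⟩]
      rw [Finset.sum_congr rfl (g := fun _ => 1 / M v), Finset.sum_const, nsmul_eq_mul]
      · have := (hMpos v).ne'
        change M v * (1 / M v) = _
        field_simp
        simp
      · intro w hw
        simp only [hM]
        rw [(Finset.mem_filter.mp hw).2]
    · rw [if_neg h, Finset.filter_false_of_mem]
      · simp
      · intro v _ hv; exact h ⟨v, hv⟩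
  have hMle : ∑ v, 1 / M v ≤ 𝒯.card := by
    rw [hMsum]; exact_mod_cast Finset.card_filter_le _ _
  have h1 : ∑ v ∈ Finset.univ.erase w, 2 / (M v * M w) ≤ 2 * 𝒯.card / M w := by
    calc _ ≤ ∑ v, 2 / (M v * M w) := by
          apply Finset.sum_le_sum_of_subset_of_nonneg (Finset.erase_subset _ _)
          intro v _ _
          have := hMpos v
          have := hMpos w
          positivity
      _ = 2 * (∑ v, 1 / M v) / M w := by
          rw [Finset.mul_sum, Finset.sum_div]
          apply Finset.sum_congr rfl
          intro v _
          rw [mul_one_div, div_div]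
      _ ≤ _ := by
          have := hMpos w
          gcongr
  set F := (Finset.univ.filter fun v => ty v = ty v0).erase w with hF
  set y : (Fin k → V) → ℝ := fun v => Bn W (q v ∘ s v) (q w ∘ s w) ^ (1 / r v0) with hy
  have hy0 : ∀ v, 0 ≤ y v := fun v => (Real.rpow_pos_of_pos (hBpos _ _) _).le
  have hr0 : 0 < r v0 := by linarith [hr v0]
  have hterm : ∀ v ∈ F, y v / (β v0 * (M v0 * M w)) ≤ H v w (s v) (s w) := by
    intro v hv
    have hv' := (Finset.mem_filter.mp (Finset.mem_of_mem_erase hv)).2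
    have eb : β v = β v0 := by simp only [hβ]; rw [hqt v v0 hv', hrt v v0 hv']
    have em : M v = M v0 := by simp only [hM]; rw [hv']
    simp only [hH, hy]
    rw [eb, em, hrt v v0 hv', ← div_div]
    have p1 := hMpos v0
    have p2 := hMpos w
    have p3 := hβpos w
    have p4 := Real.rpow_pos_of_pos (hBpos (q v ∘ s v) (q w ∘ s w)) (1 / r w)
    gcongr
    have : 0 < Bn W (q v ∘ s v) (q w ∘ s w) ^ (1 / r w) / β w := by positivity
    linarith
  have hHpos : ∀ v, 0 ≤ H v w (s v) (s w) := by
    intro v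
    have p1 := hMpos v
    have p2 := hMpos w
    have p3 := hβpos w
    have p5 := hβpos v
    have p4 := Real.rpow_pos_of_pos (hBpos (q v ∘ s v) (q w ∘ s w)) (1 / r w)
    have p6 := Real.rpow_pos_of_pos (hBpos (q v ∘ s v) (q w ∘ s w)) (1 / r v)
    simp only [hH]
    positivity
  have h2 : ∑ v ∈ F, y v / (β v0 * (M v0 * M w)) ≤ 2 * 𝒯.card / M w := by
    refine (Finset.sum_le_sum hterm).trans (le_trans ?_ ((hs w).trans h1))
    apply Finset.sum_le_sum_of_subset_of_nonneg
    · exact Finset.erase_subset_erase _ (Finset.filter_subset _ _)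
    · intro v _ _; exact hHpos v
  have h3 : ∑ v ∈ F, y v ≤ 2 * 𝒯.card * β v0 * M v0 := by
    have p1 := hMpos v0
    have p2 := hMpos w
    have p3 := hβpos v0
    rw [← Finset.sum_div, div_le_iff₀ (by positivity)] at h2
    refine h2.trans (le_of_eq ?_)
    field_simp
  calc ∑ v ∈ F, Bn W (q v ∘ s v) (q w ∘ s w) = ∑ v ∈ F, y v ^ r v0 := by
        apply Finset.sum_congr rfl
        intro v _
        simp only [hy]
        rw [← Real.rpow_mul (hBpos _ _).le, one_div_mul_cancel hr0.ne', Real.rpow_one]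
    _ ≤ (∑ v ∈ F, y v) ^ r v0 := sum_rpow_le F y hy0 _ (hr v0)
    _ ≤ _ := Real.rpow_le_rpow (Finset.sum_nonneg fun v _ => hy0 v) h3 hr0.le

end main

set_option maxHeartbeats 2000000

/-- Lemma 3, dual domain: for every admissible partition and every
choice of parameters `λ_ic > 0`, `ρ_ic ≥ 1`, there exists a code with
`p_e ≤ e^{nε} Σ_c Σ_{Pᵢ ∈ Λ_c} exp(-n[E'_x(Q_c, ρ_ic) + (λ_ic - ρ_ic) t H(Pᵢ) - t E_s(λ_ic, P_V)])`. -/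
theorem stmt3 {V X Y : Type} [Fintype V] [Fintype X] [Fintype Y]
    (PV : V → ℝ) (hPV : IsProbDist PV) (W : X → Y → ℝ) (hW : IsDMC W)
    (t : ℝ) (ht : 0 < t) (ε : ℝ) (hε : 0 < ε) :
    ∃ n₀ : ℕ, ∀ n : ℕ, n₀ ≤ n →
      ∀ (m : ℕ) (cls : (Fin ⌊t * (n : ℝ)⌋₊ → V) → Fin m) (Qc : Fin m → X → ℝ),
        AdmissiblePartition n cls Qc →
        ∀ (lam rho : Fin m → (V → ℝ) → ℝ),
          (∀ c, ∀ Pi ∈ classTypes cls c, 0 < lam c Pi ∧ 1 ≤ rho c Pi) →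
          ∃ (f : (Fin ⌊t * (n : ℝ)⌋₊ → V) → Fin n → X)
            (φ : (Fin n → Y) → Fin ⌊t * (n : ℝ)⌋₊ → V),
            pErr PV W f φ ≤ Real.exp ((n : ℝ) * ε) *
              ∑ c : Fin m, ∑ Pi ∈ classTypes cls c,
                Real.exp (-(n : ℝ) * (Ex' W (Qc c) (rho c Pi) +
                  (lam c Pi - rho c Pi) * (t * entH Pi) - t * Es PV (lam c Pi))) := by
  obtain ⟨D, hD⟩ : ∃ D : ℝ, ∀ x x', dB W x x' ≤ D := by
    refine ⟨∑ x, ∑ x', dB W x x', fun x x' => ?_⟩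
    refine le_trans ?_ (Finset.single_le_sum (f := fun x => ∑ x', dB W x x')
      (fun x _ => Finset.sum_nonneg fun x' _ => dB_nonneg W hW x x') (Finset.mem_univ x))
    exact Finset.single_le_sum (f := fun x' => dB W x x')
      (fun x' _ => dB_nonneg W hW x x') (Finset.mem_univ x')
  obtain ⟨R, hR⟩ : ∃ R : ℕ, 2 * D ^ 2 / ε + 1 ≤ R := exists_nat_ge _
  have hD2 : 0 ≤ 2 * D ^ 2 / ε := by positivity
  have hR1 : (1 : ℝ) ≤ R := by linarith
  have hDR : D ^ 2 / R ≤ ε / 2 := by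
    rw [div_le_iff₀ (by linarith)]
    have : 2 * D ^ 2 / ε ≤ R := by linarith
    rw [div_le_iff₀ hε] at this
    linarith
  set A0 : ℝ := ∑ a, |Real.log (PV a)| with hA0
  obtain ⟨n1, hn1⟩ := poly_exp t ht (ε / 2) (by linarith) (Fintype.card V) (Fintype.card X) R
    (Real.exp A0) (Real.exp_pos _)
  obtain ⟨n2, hn2⟩ := exists_nat_ge (1 / t)
  refine ⟨max (max n1 n2) 1, fun n hn => ?_⟩
  have hn1' := hn1 n (le_trans (le_trans (le_max_left _ _) (le_max_left _ _)) hn)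
  have hn2' : n2 ≤ n := le_trans (le_trans (le_max_right _ _) (le_max_left _ _)) hn
  have hn0 : 0 < n := le_trans (le_max_right _ _) hn
  have htn : 1 ≤ t * n := by
    have : (n2 : ℝ) ≤ n := by exact_mod_cast hn2'
    have h := hn2.trans this
    rw [div_le_iff₀ ht] at h
    linarith
  have hk : 0 < ⌊t * (n : ℝ)⌋₊ := Nat.floor_pos.mpr htn
  have hT1 : (⌊t * (n : ℝ)⌋₊ : ℝ) ≤ t * n := Nat.floor_le (by positivity)
  have hT2 : t * n ≤ (⌊t * (n : ℝ)⌋₊ : ℝ) + 1 := (Nat.lt_floor_add_one _).le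
  generalize ⌊t * (n : ℝ)⌋₊ = k at hk hT1 hT2 ⊢
  intro m cls Qc hadm lam rho hlr
  have : Nonempty V := by
    by_contra hcon
    rw [not_nonempty_iff] at hcon
    have := hPV.2
    simp at this
  obtain ⟨hcl, hty, -⟩ := hadm
  choose q hq using hty
  set 𝒯 : Finset (V → ℝ) := Finset.univ.image (empDist : (Fin k → V) → V → ℝ) with h𝒯
  have h𝒯mem : ∀ v : Fin k → V, empDist v ∈ 𝒯 := fun v =>
    Finset.mem_image_of_mem _ (Finset.mem_univ v)
  have hmem : ∀ v : Fin k → V, empDist v ∈ classTypes cls (cls v) := fun v =>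
    Finset.mem_image_of_mem _ (by simp)
  set r : (Fin k → V) → ℝ := fun v => min (rho (cls v) (empDist v)) R with hrdef
  have hr1 : ∀ v, 1 ≤ r v := fun v => le_min (hlr _ _ (hmem v)).2 hR1
  obtain ⟨f, hf⟩ := exists_code (V := V) W hW hn0 (k := k) empDist 𝒯 h𝒯mem (fun v => q (cls v)) r hr1
    (fun v w h => by rw [hcl v w h]) (fun v w h => by simp only [hrdef]; rw [hcl v w h, h])
  obtain ⟨φ, hφ⟩ := exists_map PV hPV W hW f
  refine ⟨f, φ, hφ.trans ?_⟩
  set M : (V → ℝ) → ℝ := fun P =>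
    ((Finset.univ.filter fun v : Fin k → V => empDist v = P).card : ℝ) with hM
  set G0 : (Fin k → V) → ℝ := fun v0 => (2 * (𝒯.card : ℝ) * (((n : ℝ) + 1) ^ Fintype.card X *
          Real.exp (-(n : ℝ) * Ex' W (empDist (q (cls v0))) (r v0) / r v0)) *
          M (empDist v0)) ^ (r v0) with hG0
  have hG0n : ∀ v, 0 ≤ G0 v := fun v => by simp only [hG0, hM]; positivity
  set G : (V → ℝ) → ℝ := Function.extend empDist G0 0 with hG
  set p : (V → ℝ) → ℝ := Function.extend empDist (prodDist PV : (Fin k → V) → ℝ) 0 with hp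
  have hpe : ∀ v : Fin k → V, p (empDist v) = prodDist PV v := by
    intro v
    refine Function.FactorsThrough.extend_apply ?_ _ v
    intro v w hvw
    by_cases hz : ∀ l, 0 < PV (v l)
    · have hz' : ∀ l, 0 < PV (w l) := by
        intro l
        have h1 := empDist_pos w l
        rw [← hvw] at h1
        obtain ⟨l', hl'⟩ := exists_of_empDist_pos v _ h1
        rw [← hl']; exact hz l'
      rw [prodDist_eq PV v hz, prodDist_eq PV w hz', hvw]
    · push Not at hz
      obtain ⟨l, hl⟩ := hz
      have h1 := empDist_pos v l
      rw [hvw] at h1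
      obtain ⟨l', hl'⟩ := exists_of_empDist_pos w _ h1
      have e1 : prodDist PV v = 0 :=
        Finset.prod_eq_zero (Finset.mem_univ l) (le_antisymm hl (hPV.1 _))
      have e2 : prodDist PV w = 0 :=
        Finset.prod_eq_zero (Finset.mem_univ l') (by rw [hl']; exact le_antisymm hl (hPV.1 _))
      rw [e1, e2]
  have hGe : ∀ v : Fin k → V, G (empDist v) = G0 v := by
    intro v
    refine Function.FactorsThrough.extend_apply ?_ _ v
    intro v w hvw
    simp only [hG0, hrdef]
    rw [hcl v w hvw, hvw]
  have hnot : ∀ P, (¬ ∃ v : Fin k → V, empDist v = P) → p P = 0 ∧ G P = 0 := by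
    intro P h
    exact ⟨Function.extend_apply' _ _ _ h, Function.extend_apply' _ _ _ h⟩
  have hpn : ∀ P, 0 ≤ p P := by
    intro P
    by_cases h : ∃ v : Fin k → V, empDist v = P
    · obtain ⟨v, rfl⟩ := h
      rw [hpe]; exact prodDist_nonneg PV hPV v
    · rw [(hnot P h).1]
  have hGn : ∀ P, 0 ≤ G P := by
    intro P
    by_cases h : ∃ v : Fin k → V, empDist v = P
    · obtain ⟨v, rfl⟩ := h
      rw [hGe]; exact hG0n v
    · rw [(hnot P h).2]
  have hcomb := combine (I := Fin k → V) empDist 𝒯 h𝒯mem p G hpn hGn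
    (fun v w => Bn W (f v) (f w)) (fun v w => Bn_symm W _ _) (by
      intro w P
      by_cases h : ∃ v : Fin k → V, empDist v = P
      · obtain ⟨v0, rfl⟩ := h
        rw [hGe]
        exact hf w v0
      · rw [Finset.filter_false_of_mem (fun v _ hv => h ⟨v, hv⟩)]
        simpa using hGn P)
  simp only [hpe] at hcomb
  refine hcomb.trans ?_
  have hsub : 𝒯 ⊆ (Finset.univ : Finset (Fin m)).biUnion (classTypes cls) := by
    intro P hP
    obtain ⟨v, _, rfl⟩ := Finset.mem_image.mp hP
    exact Finset.mem_biUnion.mpr ⟨cls v, Finset.mem_univ _, hmem v⟩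
  have hdisj : ((Finset.univ : Finset (Fin m)) : Set (Fin m)).PairwiseDisjoint
      (classTypes cls) := by
    intro c _ c' _ hcc
    rw [Function.onFun, Finset.disjoint_left]
    intro P h1 h2
    obtain ⟨v, hv, rfl⟩ := Finset.mem_image.mp h1
    obtain ⟨w, hw, hvw⟩ := Finset.mem_image.mp h2
    apply hcc
    rw [← (Finset.mem_filter.mp hv).2, ← (Finset.mem_filter.mp hw).2]
    exact hcl _ _ hvw.symm
  have hnn : ∀ P, 0 ≤ p P * M P * G P := fun P =>
    mul_nonneg (mul_nonneg (hpn P) (Nat.cast_nonneg _)) (hGn P)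
  have hstep : ∑ P ∈ 𝒯, p P * M P * G P ≤ ∑ c : Fin m, ∑ P ∈ classTypes cls c,
      p P * M P * G P := by
    rw [← Finset.sum_biUnion hdisj]
    exact Finset.sum_le_sum_of_subset_of_nonneg hsub fun P _ _ => hnn P
  refine (mul_le_mul_of_nonneg_left hstep (Nat.cast_nonneg _)).trans ?_
  rw [Finset.mul_sum, Finset.mul_sum]
  apply Finset.sum_le_sum
  intro c _
  rw [Finset.mul_sum, Finset.mul_sum]
  apply Finset.sum_le_sum
  intro P hP
  obtain ⟨hl, hrho⟩ := hlr c P hP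
  obtain ⟨v, hv, rfl⟩ := Finset.mem_image.mp hP
  have hvc : cls v = c := (Finset.mem_filter.mp hv).2
  subst hvc
  rw [hpe, hGe]
  have hQ : IsProbDist (Qc (cls v)) := by rw [← hq]; exact empDist_prob hn0 _
  have hrv : 1 ≤ r v := hr1 v
  have hrR : r v ≤ R := min_le_right _ _
  have hrrho : r v ≤ rho (cls v) (empDist v) := min_le_left _ _
  have hsrc := src_term PV hPV hk v (t * n) hT1 hT2 (lam (cls v) (empDist v))
    (rho (cls v) (empDist v)) (r v) hl (by linarith) hrrho
  have hEx : Ex' W (Qc (cls v)) (rho (cls v) (empDist v)) ≤ Ex' W (Qc (cls v)) (r v) + ε / 2 := by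
    rcases le_total (rho (cls v) (empDist v)) R with h | h
    · have : r v = rho (cls v) (empDist v) := min_eq_left h
      rw [this]; linarith
    · have : r v = R := min_eq_right h
      rw [this]
      have := Ex'_compare W hW _ hQ (rho (cls v) (empDist v)) R (by linarith) (by linarith) D hD
      linarith
  have hNpos : (1 : ℝ) ≤ 𝒯.card := by
    exact_mod_cast Finset.card_pos.mpr ⟨_, h𝒯mem v⟩
  have hN : (𝒯.card : ℝ) ≤ (t * n + 1) ^ Fintype.card V := by
    calc (𝒯.card : ℝ) ≤ ((k : ℝ) + 1) ^ Fintype.card V := by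
          exact_mod_cast types_card (V := V) (k := k)
      _ ≤ _ := by gcongr
  set N : ℝ := (𝒯.card : ℝ) with hNdef
  set L : ℝ := ((n : ℝ) + 1) ^ Fintype.card X with hLdef
  have hL : 1 ≤ L := one_le_pow₀ (by linarith [(Nat.cast_nonneg n : (0 : ℝ) ≤ n)])
  have hMn : 0 ≤ M (empDist v) := Nat.cast_nonneg _
  have hGval : G0 v = (2 * N * L) ^ r v * (Real.exp (-(n : ℝ) * Ex' W (Qc (cls v)) (r v)) *
      M (empDist v) ^ r v) := by
    simp only [hG0]
    rw [hq, show 2 * N * (L * Real.exp (-(n : ℝ) * Ex' W (Qc (cls v)) (r v) / r v)) *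
      M (empDist v) = (2 * N * L) * (Real.exp (-(n : ℝ) * Ex' W (Qc (cls v)) (r v) / r v) *
      M (empDist v)) by ring]
    rw [Real.mul_rpow (by positivity) (by positivity), Real.mul_rpow (by positivity) hMn,
      ← Real.exp_mul, div_mul_cancel₀ _ (by linarith)]
  have hpoly : (2 * N * L) ^ r v ≤ (2 * N * L) ^ R := by
    rw [← Real.rpow_natCast]
    apply Real.rpow_le_rpow_of_exponent_le _ hrR
    nlinarith
  have hbig : N * (2 * N * L) ^ R * Real.exp A0 ≤ Real.exp (n * (ε / 2)) := by
    refine le_trans ?_ hn1'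
    gcongr
  rw [hGval]
  set Er := Ex' W (Qc (cls v)) (r v) with hEr
  set Z := t * ↑n * (Es PV (lam (cls v) (empDist v)) - (lam (cls v) (empDist v) -
    rho (cls v) (empDist v)) * entH (empDist v)) with hZ
  calc N * (prodDist PV v * M (empDist v) * ((2 * N * L) ^ r v * (Real.exp (-(n : ℝ) * Er) *
      M (empDist v) ^ r v)))
      = N * (2 * N * L) ^ r v * Real.exp (-(n : ℝ) * Er) *
        (prodDist PV v * M (empDist v) * M (empDist v) ^ r v) := by ring
    _ ≤ N * (2 * N * L) ^ R * Real.exp (-(n : ℝ) * Er) * (Real.exp A0 * Real.exp Z) := by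
        have := prodDist_nonneg PV hPV v
        gcongr
    _ = (N * (2 * N * L) ^ R * Real.exp A0) * (Real.exp (-(n : ℝ) * Er) * Real.exp Z) := by ring
    _ ≤ Real.exp (n * (ε / 2)) * (Real.exp (-(n : ℝ) * Er) * Real.exp Z) := by gcongr
    _ = Real.exp (n * (ε / 2) + (-(n : ℝ) * Er + Z)) := by rw [Real.exp_add, Real.exp_add]
    _ ≤ _ := by
        rw [← Real.exp_add]
        apply Real.exp_le_exp.mpr
        have hnn' : (0 : ℝ) ≤ n := Nat.cast_nonneg n
        have := mul_le_mul_of_nonneg_left hEx hnn'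
        rw [hZ]
        linarith

end
end
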